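/- Let (X, μ) be a σ-finite measure space and 1 < p < ∞. Let T : L^p(X, μ) → L^p(X, μ) be an invertible bounded linear operator with K := sup_{k ∈ ℤ} ‖T^k‖ < ∞. Then there exists a constant C, depending only on p and K, such that for every N ∈ ℕ, every strictly increasing finite sequence n_0 < n_1 < ⋯ < n_N of positive integers, and every x ∈ L^p(X, μ), one has ‖ ( ∑_{i=0}^{N-1} |B_{n_i}(T)x − B_{n_{i+1}}(T)x|^2 )^{1/2} ‖_{L^p(X,μ)} ≤ C ‖x‖_{L^p(X,μ)}. (This is the commutative case of Theorem 1.1 for the two-sided ergodic averages.) -/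

import Mathlib

open MeasureTheory Finset ENNReal

/-- Two-sided ergodic average `B_n(T) = (1/(2n+1)) ∑_{k=-n}^{n} T^k` of an invertible
operator `T`. -/
noncomputable def ergAvgTwoSided {X : Type*} [MeasurableSpace X] {μ : MeasureTheory.Measure X}
    {p : ℝ≥0∞} [Fact (1 ≤ p)]
    (T : Lp ℂ p μ ≃L[ℂ] Lp ℂ p μ) (n : ℕ) : Lp ℂ p μ →L[ℂ] Lp ℂ p μ :=
  ((2 * (n : ℂ) + 1))⁻¹ •
    ∑ k ∈ Finset.Icc (-(n : ℤ)) (n : ℤ),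
      ((T ^ k : Lp ℂ p μ ≃L[ℂ] Lp ℂ p μ) : Lp ℂ p μ →L[ℂ] Lp ℂ p μ)



lemma lc_pow (s u : ℝ) (hs : -1 < s) (hu : 0 ≤ u) :
    ∫⁻ l in Set.Ioi (0:ℝ), ENNReal.ofReal (if l < u then l ^ s else 0)
      = ENNReal.ofReal (u ^ (s+1) / (s+1)) := by
  have h1 : ∫⁻ l in Set.Ioi (0:ℝ), ENNReal.ofReal (if l < u then l ^ s else 0)
      = ∫⁻ l in Set.Ioo (0:ℝ) u, ENNReal.ofReal (l ^ s) := by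
    rw [← lintegral_indicator measurableSet_Ioi, ← lintegral_indicator measurableSet_Ioo]
    congr 1
    ext l
    simp only [Set.indicator, Set.mem_Ioi, Set.mem_Ioo]
    by_cases h : 0 < l <;> by_cases h' : l < u <;> simp [h, h']
  rw [h1, setLIntegral_congr Ioo_ae_eq_Ioc]
  have hi := intervalIntegral.intervalIntegrable_rpow' (a := 0) (b := u) hs
  rw [← ofReal_integral_eq_lintegral_ofReal]
  · congr 1
    rw [← intervalIntegral.integral_of_le hu, integral_rpow (Or.inl hs)]
    rw [Real.zero_rpow (by linarith), sub_zero]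
  · exact (intervalIntegrable_iff_integrableOn_Ioc_of_le hu).1 hi
  · filter_upwards [ae_restrict_mem measurableSet_Ioc] with l hl
    exact Real.rpow_nonneg hl.1.le _

lemma lc_tail (p φ : ℝ) (hp : p < 2) (hφ : 0 ≤ φ) :
    ∫⁻ l in Set.Ioi (0:ℝ), ENNReal.ofReal (if φ ≤ l then φ ^ 2 * l ^ (p - 3) else 0)
      ≤ ENNReal.ofReal (φ ^ p / (2 - p)) := by
  rcases hφ.eq_or_lt with h0 | h0
  · subst h0; simp
  have h1 : ∫⁻ l in Set.Ioi (0:ℝ), ENNReal.ofReal (if φ ≤ l then φ ^ 2 * l ^ (p - 3) else 0)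
      = ∫⁻ l in Set.Ici φ, ENNReal.ofReal (φ ^ 2 * l ^ (p - 3)) := by
    rw [← lintegral_indicator measurableSet_Ioi, ← lintegral_indicator measurableSet_Ici]
    congr 1
    ext l
    simp only [Set.indicator, Set.mem_Ioi, Set.mem_Ici]
    by_cases h : 0 < l <;> by_cases h' : φ ≤ l <;> simp [h, h']
    linarith
  rw [h1, setLIntegral_congr Ioi_ae_eq_Ici.symm]
  have hi : IntegrableOn (fun l : ℝ => l ^ (p-3)) (Set.Ioi φ) :=
    integrableOn_Ioi_rpow_of_lt (by linarith) h0
  rw [← ofReal_integral_eq_lintegral_ofReal]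
  · apply le_of_eq
    congr 1
    rw [integral_const_mul, integral_Ioi_rpow_of_lt (by linarith) h0]
    have : φ ^ p = φ ^ 2 * φ ^ (p - 3 + 1) := by
      rw [← Real.rpow_natCast, ← Real.rpow_add h0]; congr 1; push_cast; ring
    rw [this]
    have h2 : p - 3 + 1 ≠ 0 := by linarith
    have h3 : 2 - p ≠ 0 := by linarith
    field_simp
    ring
  · exact hi.const_mul _
  · filter_upwards [ae_restrict_mem measurableSet_Ioi] with l hl
    have : 0 < l := h0.trans hl
    positivity

lemma lc_main (p A : ℝ) (hp1 : 1 < p) (hp2 : p < 2) (hA : 0 ≤ A) :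
    ∃ C : ℝ, 0 < C ∧ ∀ (W' W : Finset ℤ) (u φ : ℤ → ℝ), (∀ x, 0 ≤ u x) → (∀ x, 0 ≤ φ x) →
      (∀ l : ℝ, 0 < l → ((W'.filter (fun x => l < u x)).card : ℝ)
        ≤ A / l * ∑ x ∈ W.filter (fun x => l / 2 < φ x), φ x
          + A / l ^ 2 * ∑ x ∈ W.filter (fun x => φ x ≤ l), φ x ^ 2) →
      ∑ x ∈ W', u x ^ p ≤ C * ∑ x ∈ W, φ x ^ p := by
  refine ⟨p * (A * (2 ^ (p-1) / (p-1)) + A * (1 / (2 - p))) + 1, ?_, ?_⟩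
  · have : 0 < p - 1 := by linarith
    have : 0 < 2 - p := by linarith
    positivity
  intro W' W u φ hu hφ H
  have hp1' : 0 < p - 1 := by linarith
  have hp2' : 0 < 2 - p := by linarith
  have hS : 0 ≤ ∑ x ∈ W, φ x ^ p := sum_nonneg fun x _ => Real.rpow_nonneg (hφ x) _
  -- pointwise inequality for the integrands
  have key : ∫⁻ l in Set.Ioi (0:ℝ), ∑ x ∈ W', ENNReal.ofReal (if l < u x then l ^ (p-1) else 0)
      ≤ ∫⁻ l in Set.Ioi (0:ℝ), ((∑ x ∈ W, ENNReal.ofReal (A * φ x) *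
            ENNReal.ofReal (if l < 2 * φ x then l ^ (p-2) else 0))
          + ∑ x ∈ W, ENNReal.ofReal A * ENNReal.ofReal (if φ x ≤ l then φ x ^ 2 * l ^ (p - 3) else 0)) := by
    apply setLIntegral_mono_ae' measurableSet_Ioi
    refine Filter.Eventually.of_forall fun l hl => ?_
    have hl : 0 < l := hl
    have hc := H l hl
    have e1 : ∀ x, ENNReal.ofReal (A * φ x) * ENNReal.ofReal (if l < 2 * φ x then l ^ (p-2) else 0)
        = ENNReal.ofReal (A * φ x * (if l < 2 * φ x then l ^ (p-2) else 0)) := fun x => by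
      rw [ENNReal.ofReal_mul (mul_nonneg hA (hφ x))]
    have e2 : ∀ x, ENNReal.ofReal A * ENNReal.ofReal (if φ x ≤ l then φ x ^ 2 * l ^ (p - 3) else 0)
        = ENNReal.ofReal (A * (if φ x ≤ l then φ x ^ 2 * l ^ (p - 3) else 0)) := fun x => by
      rw [ENNReal.ofReal_mul hA]
    simp only [e1, e2]
    have n1 : ∀ x ∈ W, 0 ≤ A * φ x * (if l < 2 * φ x then l ^ (p-2) else 0) := fun x _ => by
      have := hφ x
      split_ifs <;> positivity
    have n2 : ∀ x ∈ W, 0 ≤ A * (if φ x ≤ l then φ x ^ 2 * l ^ (p - 3) else 0) := fun x _ => by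
      have := hφ x
      split_ifs <;> positivity
    rw [← ENNReal.ofReal_sum_of_nonneg, ← ENNReal.ofReal_sum_of_nonneg n1,
      ← ENNReal.ofReal_sum_of_nonneg n2, ← ENNReal.ofReal_add (sum_nonneg n1) (sum_nonneg n2)]
    · apply ENNReal.ofReal_le_ofReal
      rw [← Finset.sum_filter, sum_const, nsmul_eq_mul]
      have hlp : 0 ≤ l ^ (p-1) := Real.rpow_nonneg hl.le _
      refine (mul_le_mul_of_nonneg_right hc hlp).trans (le_of_eq ?_)
      rw [add_mul]
      have r1 : l ^ (p-1) = l ^ (p-2) * l := by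
        rw [← Real.rpow_add_one hl.ne']; congr 1; ring
      have r2 : l ^ (p-2) = l ^ (p-3) * l := by
        rw [← Real.rpow_add_one hl.ne']; congr 1; ring
      congr 1
      · rw [sum_filter, mul_sum, sum_mul]
        refine sum_congr rfl fun x _ => ?_
        have : (l / 2 < φ x) ↔ l < 2 * φ x := by constructor <;> intro h <;> linarith
        simp only [this]
        split_ifs
        · rw [r1]; field_simp
        · simp
      · rw [sum_filter, mul_sum, sum_mul]
        refine sum_congr rfl fun x _ => ?_
        split_ifs
        · rw [r1, r2]; field_simp
        · simp
    · intro x _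
      split_ifs <;> positivity
  have m1 : ∀ (s a : ℝ), Measurable fun l : ℝ => ENNReal.ofReal (if l < a then l ^ s else 0) := by
    intro s a
    exact (Measurable.ite measurableSet_Iio (by fun_prop) measurable_const).ennreal_ofReal
  have m2 : ∀ (s a : ℝ), Measurable fun l : ℝ =>
      ENNReal.ofReal (if a ≤ l then a ^ 2 * l ^ s else 0) := by
    intro s a
    exact (Measurable.ite measurableSet_Ici (by fun_prop) measurable_const).ennreal_ofReal
  rw [lintegral_finsetSum _ (fun x _ => m1 _ _), lintegral_add_left,
    lintegral_finsetSum, lintegral_finsetSum] at key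
  rotate_left
  · intro x _; exact (m2 _ _).const_mul _
  · intro x _; exact (m1 _ _).const_mul _
  · exact Finset.measurable_sum _ fun x _ => (m1 _ _).const_mul _
  have key2 : ∑ x ∈ W', ENNReal.ofReal (u x ^ p / p) ≤
      (∑ x ∈ W, ENNReal.ofReal (A * φ x * ((2 * φ x) ^ (p-1) / (p-1))))
       + ∑ x ∈ W, ENNReal.ofReal (A * (φ x ^ p / (2 - p))) := by
    refine le_trans (le_of_eq ?_) (key.trans (add_le_add ?_ ?_))
    · refine sum_congr rfl fun x _ => ?_
      rw [lc_pow _ _ (by linarith) (hu x)]; simp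
    · refine sum_le_sum fun x _ => ?_
      rw [lintegral_const_mul _ (m1 _ _), lc_pow _ _ (by linarith) (by linarith [hφ x]),
        ← ENNReal.ofReal_mul (mul_nonneg hA (hφ x))]
      apply le_of_eq; congr 2; ring_nf
    · refine sum_le_sum fun x _ => ?_
      rw [lintegral_const_mul _ (m2 _ _), ENNReal.ofReal_mul hA]
      gcongr
      exact lc_tail p _ hp2 (hφ x)
  rw [← ENNReal.ofReal_sum_of_nonneg, ← ENNReal.ofReal_sum_of_nonneg,
    ← ENNReal.ofReal_sum_of_nonneg, ← ENNReal.ofReal_add, ENNReal.ofReal_le_ofReal_iff] at key2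
  rotate_left
  · refine add_nonneg (sum_nonneg fun x _ => ?_) (sum_nonneg fun x _ => ?_) <;>
    · have := hφ x; positivity
  · refine (sum_nonneg fun x _ => ?_); have := hφ x; positivity
  · refine (sum_nonneg fun x _ => ?_); have := hφ x; positivity
  · intro x _; have := hφ x; positivity
  · intro x _; have := hφ x; positivity
  · intro x _; have := hu x; positivity
  rw [← sum_div] at key2
  have e3 : ∀ x, A * φ x * ((2 * φ x) ^ (p-1) / (p-1)) = A * (2 ^ (p-1) / (p-1)) * φ x ^ p := by
    intro x
    rcases (hφ x).eq_or_lt with h0 | h0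
    · rw [← h0, Real.zero_rpow (by linarith)]; simp
    · rw [Real.mul_rpow (by norm_num) h0.le]
      have : φ x ^ p = φ x ^ (p-1) * φ x := by rw [← Real.rpow_add_one h0.ne']; congr 1; ring
      rw [this]; ring
  have e4 : ∀ x, A * (φ x ^ p / (2 - p)) = A * (1 / (2 - p)) * φ x ^ p := by intro x; ring
  simp only [e3, e4] at key2
  rw [← mul_sum, ← mul_sum, div_le_iff₀ (by linarith)] at key2
  nlinarith [key2]



/-- points covered by an interval on which the average of `φ` exceeds `l` -/
def bigSet (φ : ℤ → ℝ) (l : ℝ) : Set ℤ :=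
  {x | ∃ a b : ℤ, a ≤ x ∧ x ≤ b ∧ l * ((b:ℝ) - a + 1) < ∑ k ∈ Icc a b, φ k}

lemma int_decomp (n : ℕ) : ∀ (Ω : Finset ℤ), Ω.card = n → ∃ Q : Finset (ℤ × ℤ),
    (∀ q ∈ Q, q.1 ≤ q.2) ∧ (∀ q ∈ Q, q.1 - 1 ∉ Ω) ∧
    (∀ q ∈ Q, ∀ q' ∈ Q, q ≠ q' → Disjoint (Icc q.1 q.2) (Icc q'.1 q'.2)) ∧
    (∀ x, x ∈ Ω ↔ ∃ q ∈ Q, x ∈ Icc q.1 q.2) := by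
  induction n using Nat.strong_induction_on with
  | _ n ih =>
  intro Ω hn
  rcases Ω.eq_empty_or_nonempty with h | h
  · subst h; exact ⟨∅, by simp⟩
  set r := Ω.max' h with hr
  have hrΩ : r ∈ Ω := Ω.max'_mem h
  have hmax : ∀ x ∈ Ω, x ≤ r := fun x hx => Ω.le_max' x hx
  -- left end point
  have hex : ∃ m : ℕ, r - m - 1 ∉ Ω := by
    refine ⟨(r - Ω.min' h).toNat, fun hc => ?_⟩
    have := Ω.min'_le _ hc
    have := Ω.min'_le _ hrΩ
    omega
  classical
  set m := Nat.find hex with hm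
  have hm1 : r - m - 1 ∉ Ω := Nat.find_spec hex
  have hm2 : ∀ x, r - m ≤ x → x ≤ r → x ∈ Ω := by
    intro x h1 h2
    by_cases hx : x = r
    · rw [hx]; exact hrΩ
    have hlt : (r - x - 1).toNat < m := by omega
    have := Nat.find_min hex hlt
    have e : r - ((r - x - 1).toNat : ℤ) - 1 = x := by omega
    rw [e] at this
    simpa using this
  set Ω' := Ω.filter (fun x => x < r - m) with hΩ'
  have hcard : Ω'.card < n := by
    rw [← hn]
    apply card_lt_card
    refine ⟨filter_subset _ _, fun hc => ?_⟩
    have := (mem_filter.1 (hc hrΩ)).2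
    omega
  obtain ⟨Q, h1, h2, h3, h4⟩ := ih _ hcard Ω' rfl
  have hQ : ∀ q ∈ Q, q.2 < r - m := by
    intro q hq
    have : q.2 ∈ Ω' := (h4 _).2 ⟨q, hq, by simp [h1 q hq]⟩
    exact (mem_filter.1 this).2
  refine ⟨insert (r - m, r) Q, ?_, ?_, ?_, ?_⟩
  · intro q hq
    rcases mem_insert.1 hq with rfl | hq
    · simp
    · exact h1 q hq
  · intro q hq
    rcases mem_insert.1 hq with rfl | hq
    · exact hm1
    · intro hc
      apply h2 q hq
      have := hQ q hq
      have := h1 q hq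
      exact mem_filter.2 ⟨hc, by omega⟩
  · intro q hq q' hq' hne
    rw [Finset.disjoint_left]
    intro x hx hx'
    rw [mem_Icc] at hx hx'
    rcases mem_insert.1 hq with rfl | hq <;> rcases mem_insert.1 hq' with rfl | hq'
    · exact hne rfl
    · have := hQ q' hq'; simp at hx; omega
    · have := hQ q hq; simp at hx'; omega
    · exact Finset.disjoint_left.1 (h3 q hq q' hq' hne) (mem_Icc.2 hx) (mem_Icc.2 hx')
  · intro x
    constructor
    · intro hx
      by_cases hxm : x < r - m
      · obtain ⟨q, hq, hxq⟩ := (h4 x).1 (mem_filter.2 ⟨hx, hxm⟩)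
        exact ⟨q, mem_insert_of_mem hq, hxq⟩
      · exact ⟨_, mem_insert_self _ _, mem_Icc.2 ⟨by simpa using hxm, hmax x hx⟩⟩
    · rintro ⟨q, hq, hxq⟩
      rcases mem_insert.1 hq with rfl | hq
      · rw [mem_Icc] at hxq; exact hm2 x hxq.1 hxq.2
      · exact (mem_filter.1 ((h4 x).2 ⟨q, hq, hxq⟩)).1

lemma icc_card_real (a b : ℤ) (h : a ≤ b + 1) : ((Icc a b).card : ℝ) = (b:ℝ) - a + 1 := by
  rw [Int.card_Icc]
  have : ((b + 1 - a).toNat : ℤ) = b + 1 - a := by omega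
  have h2 : (((b + 1 - a).toNat : ℤ) : ℝ) = ((b + 1 - a : ℤ) : ℝ) := by rw [this]
  push_cast at h2
  rw [h2]; ring

lemma weak_aux (φ : ℤ → ℝ) (hφ : ∀ x, 0 ≤ φ x) (l : ℝ) (hl : 0 < l) (a b : ℤ → ℤ) (n : ℕ) :
    ∀ (S : Finset ℤ), S.card = n → (∀ x ∈ S, a x ≤ x ∧ x ≤ b x ∧
      l * ((b x:ℝ) - a x + 1) < ∑ k ∈ Icc (a x) (b x), φ k) →
    l * S.card ≤ 3 * ∑ k ∈ S.biUnion (fun x => Icc (a x) (b x)), φ k := by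
  induction n using Nat.strong_induction_on with
  | _ n ih =>
  intro S hn hS
  rcases S.eq_empty_or_nonempty with h | h
  · subst h; simp
  obtain ⟨x0, hx0, hmax⟩ := S.exists_max_image (fun x => b x - a x) h
  classical
  set S' := S.filter (fun x => Disjoint (Icc (a x) (b x)) (Icc (a x0) (b x0))) with hS'
  set S'' := S.filter (fun x => ¬ Disjoint (Icc (a x) (b x)) (Icc (a x0) (b x0))) with hS''
  have h0 := hS x0 hx0
  have hcs : S'.card + S''.card = S.card := card_filter_add_card_filter_not _
  have hx0'' : x0 ∈ S'' := by
    refine mem_filter.2 ⟨hx0, fun hd => ?_⟩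
    exact Finset.disjoint_left.1 hd (mem_Icc.2 ⟨h0.1, h0.2.1⟩) (mem_Icc.2 ⟨h0.1, h0.2.1⟩)
  have hpos : 0 < S''.card := card_pos.2 ⟨_, hx0''⟩
  have hI := ih S'.card (by omega) S' rfl (fun x hx => hS x (mem_filter.1 hx).1)
  have hsub : S'' ⊆ Icc (a x0 - (b x0 - a x0)) (b x0 + (b x0 - a x0)) := by
    intro x hx
    obtain ⟨hx, hd⟩ := mem_filter.1 hx
    rw [Finset.not_disjoint_iff] at hd
    obtain ⟨y, hy, hy'⟩ := hd
    rw [mem_Icc] at hy hy' ⊢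
    have := hmax x hx
    have := hS x hx
    omega
  have hc2 : (S''.card : ℝ) ≤ 3 * ((b x0:ℝ) - a x0 + 1) := by
    have h1 := card_le_card hsub
    have h2 : (S''.card : ℝ) ≤ ((Icc (a x0 - (b x0 - a x0)) (b x0 + (b x0 - a x0))).card : ℝ) := by
      exact_mod_cast h1
    rw [icc_card_real _ _ (by omega)] at h2
    push_cast at h2
    linarith
  have hdis : Disjoint (S'.biUnion (fun x => Icc (a x) (b x))) (Icc (a x0) (b x0)) := by
    rw [Finset.disjoint_biUnion_left]
    intro x hx
    exact (mem_filter.1 hx).2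
  have hsum : ∑ k ∈ S'.biUnion (fun x => Icc (a x) (b x)), φ k + ∑ k ∈ Icc (a x0) (b x0), φ k
      ≤ ∑ k ∈ S.biUnion (fun x => Icc (a x) (b x)), φ k := by
    rw [← sum_union hdis]
    apply sum_le_sum_of_subset_of_nonneg
    · apply union_subset
      · exact biUnion_subset_biUnion_of_subset_left _ (filter_subset _ _)
      · exact subset_biUnion_of_mem (fun x => Icc (a x) (b x)) hx0
    · intros; exact hφ _
  have hcr : (S.card : ℝ) = S'.card + S''.card := by exact_mod_cast hcs.symm
  rw [hcr]
  have := mul_le_mul_of_nonneg_left hc2 hl.le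
  nlinarith [h0.2.2]

lemma sum_sub_supp (φ : ℤ → ℝ) (hφ : ∀ x, 0 ≤ φ x) (W : Finset ℤ) (hW : ∀ x ∉ W, φ x = 0)
    (S : Finset ℤ) : ∑ x ∈ S, φ x ≤ ∑ x ∈ W, φ x := by
  classical
  calc ∑ x ∈ S, φ x ≤ ∑ x ∈ S ∪ W, φ x :=
        sum_le_sum_of_subset_of_nonneg subset_union_left fun x _ _ => hφ x
    _ = ∑ x ∈ W, φ x := (sum_subset subset_union_right fun x _ hx => hW x hx).symm

lemma weak_one (φ : ℤ → ℝ) (hφ : ∀ x, 0 ≤ φ x) (W : Finset ℤ) (hW : ∀ x ∉ W, φ x = 0)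
    (l : ℝ) (hl : 0 < l) (S : Finset ℤ) (hS : ∀ x ∈ S, x ∈ bigSet φ l) :
    l * S.card ≤ 3 * ∑ k ∈ W, φ k := by
  choose! a b h using hS
  have := weak_aux φ hφ l hl a b S.card S rfl (fun x hx => h x hx)
  linarith [sum_sub_supp φ hφ W hW (S.biUnion (fun x => Icc (a x) (b x)))]

lemma weak_two (φ : ℤ → ℝ) (hφ : ∀ x, 0 ≤ φ x) (W : Finset ℤ) (hW : ∀ x ∉ W, φ x = 0)
    (l : ℝ) (hl : 0 < l) (S : Finset ℤ) (hS : ∀ x ∈ S, x ∈ bigSet φ l) :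
    (S.card : ℝ) ≤ 6 / l * ∑ x ∈ W.filter (fun x => l / 2 < φ x), φ x := by
  have hS' : ∀ x ∈ S, x ∈ bigSet (fun x => if l / 2 < φ x then φ x else 0) (l/2) := by
    intro x hx
    obtain ⟨a, b, h1, h2, h3⟩ := hS x hx
    refine ⟨a, b, h1, h2, ?_⟩
    have : ∑ k ∈ Icc a b, φ k ≤ ∑ k ∈ Icc a b, ((if l / 2 < φ k then φ k else 0) + l / 2) := by
      refine sum_le_sum fun k _ => ?_
      split_ifs with h <;> linarith
    rw [sum_add_distrib, sum_const, nsmul_eq_mul, icc_card_real _ _ (by omega)] at this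
    linarith
  have := weak_one _ (fun x => by split_ifs; exacts [hφ x, le_rfl]) W
    (fun x hx => by simp [hW x hx]) (l/2) (by linarith) S hS'
  rw [← sum_filter] at this
  rw [div_mul_eq_mul_div, le_div_iff₀ hl]
  linarith

lemma bigSet_finite (φ : ℤ → ℝ) (hφ : ∀ x, 0 ≤ φ x) (W : Finset ℤ) (hW : ∀ x ∉ W, φ x = 0)
    (l : ℝ) (hl : 0 < l) : (bigSet φ l).Finite := by
  by_contra hc
  have hc : (bigSet φ l).Infinite := hc
  obtain ⟨n, hn⟩ := exists_nat_gt ((3 * ∑ k ∈ W, φ k) / l)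
  obtain ⟨S, hS, hcard⟩ := hc.exists_subset_card_eq n
  have := weak_one φ hφ W hW l hl S (fun x hx => hS hx)
  rw [hcard] at this
  rw [div_lt_iff₀ hl] at hn
  linarith

/-- uncentered maximal function -/
noncomputable def HLM (φ : ℤ → ℝ) (x : ℤ) : ℝ :=
  ⨆ q : ℕ × ℕ, (∑ k ∈ Icc (x - q.1) (x + q.2), φ k) / ((q.1:ℝ) + q.2 + 1)

lemma HLM_bdd (φ : ℤ → ℝ) (hφ : ∀ x, 0 ≤ φ x) (W : Finset ℤ) (hW : ∀ x ∉ W, φ x = 0) (x : ℤ) :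
    BddAbove (Set.range fun q : ℕ × ℕ =>
      (∑ k ∈ Icc (x - q.1) (x + q.2), φ k) / ((q.1:ℝ) + q.2 + 1)) := by
  refine ⟨∑ k ∈ W, φ k, ?_⟩
  rintro _ ⟨q, rfl⟩
  have h1 := sum_sub_supp φ hφ W hW (Icc (x - q.1) (x + q.2))
  have h0 : 0 ≤ ∑ k ∈ W, φ k := sum_nonneg fun x _ => hφ x
  dsimp only
  rw [div_le_iff₀ (by positivity)]
  have : (0:ℝ) ≤ (q.1:ℝ) + q.2 := by positivity
  nlinarith

lemma HLM_nonneg (φ : ℤ → ℝ) (hφ : ∀ x, 0 ≤ φ x) (x : ℤ) : 0 ≤ HLM φ x :=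
  Real.iSup_nonneg fun q => div_nonneg (sum_nonneg fun x _ => hφ x) (by positivity)

lemma HLM_ge (φ : ℤ → ℝ) (hφ : ∀ x, 0 ≤ φ x) (W : Finset ℤ) (hW : ∀ x ∉ W, φ x = 0) (x a b : ℤ)
    (ha : a ≤ x) (hb : x ≤ b) : ∑ k ∈ Icc a b, φ k ≤ ((b:ℝ) - a + 1) * HLM φ x := by
  have := le_ciSup (HLM_bdd φ hφ W hW x) ((x - a).toNat, (b - x).toNat)
  have e1 : ((x - a).toNat : ℤ) = x - a := by omega
  have e2 : ((b - x).toNat : ℤ) = b - x := by omega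
  have e1' : ((x - a).toNat : ℝ) = x - a := by exact_mod_cast e1
  have e2' : ((b - x).toNat : ℝ) = b - x := by exact_mod_cast e2
  dsimp only at this
  rw [e1, e2, e1', e2'] at this
  have hab : (a:ℝ) ≤ b := by exact_mod_cast ha.trans hb
  rw [show x - (x - a) = a by ring, show x + (b - x) = b by ring, div_le_iff₀ (by linarith)] at this
  calc _ ≤ _ := this
    _ = _ := by unfold HLM; ring

lemma HLM_bigSet (φ : ℤ → ℝ) (x : ℤ) (l : ℝ) (h : l < HLM φ x) : x ∈ bigSet φ l := by
  obtain ⟨q, hq⟩ := exists_lt_of_lt_ciSup h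
  refine ⟨x - q.1, x + q.2, by omega, by omega, ?_⟩
  rw [lt_div_iff₀ (by positivity)] at hq
  refine lt_of_eq_of_lt ?_ hq
  push_cast
  ring

lemma HLM_strong (p : ℝ) (hp1 : 1 < p) (hp2 : p < 2) :
    ∃ C : ℝ, 0 < C ∧ ∀ (W' W : Finset ℤ) (φ : ℤ → ℝ), (∀ x, 0 ≤ φ x) → (∀ x ∉ W, φ x = 0) →
      ∑ x ∈ W', HLM φ x ^ p ≤ C * ∑ x ∈ W, φ x ^ p := by
  obtain ⟨C, hC, H⟩ := lc_main p 6 hp1 hp2 (by norm_num)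
  refine ⟨C, hC, fun W' W φ hφ hW => ?_⟩
  apply H _ _ _ _ (HLM_nonneg φ hφ) hφ
  intro l hl
  have := weak_two φ hφ W hW l hl (W'.filter (fun x => l < HLM φ x))
    (fun x hx => HLM_bigSet _ _ _ (mem_filter.1 hx).2)
  have h2 : 0 ≤ 6 / l ^ 2 * ∑ x ∈ W.filter (fun x => φ x ≤ l), φ x ^ 2 := by positivity
  linarith


/-- finite family of pairwise disjoint nonempty intervals -/
def IFam (Q : Finset (ℤ × ℤ)) : Prop :=
  (∀ q ∈ Q, q.1 ≤ q.2) ∧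
    (∀ q ∈ Q, ∀ q' ∈ Q, q ≠ q' → Disjoint (Icc q.1 q.2) (Icc q'.1 q'.2))

/-- threefold enlargement -/
noncomputable def starI (q : ℤ × ℤ) : Finset ℤ := Icc (q.1 - (q.2 - q.1 + 1)) (q.2 + (q.2 - q.1 + 1))

/-- off-diagonal estimate for bad functions -/
def HOff {E F : Type} [NormedAddCommGroup E] [NormedAddCommGroup F] (A : ℝ)
    (T : (ℤ → E) → (ℤ → F)) : Prop :=
  ∀ (l : ℝ), 0 < l → ∀ (Q : Finset (ℤ × ℤ)), IFam Q → ∀ b : ℤ → E,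
    (∀ x, (∀ q ∈ Q, x ∉ Icc q.1 q.2) → b x = 0) →
    (∀ q ∈ Q, ∑ x ∈ Icc q.1 q.2, b x = 0) →
    (∀ q ∈ Q, ∑ x ∈ Icc q.1 q.2, ‖b x‖ ≤ l * ((q.2:ℝ) - q.1 + 1)) →
    ∀ W' : Finset ℤ, (∀ x ∈ W', ∀ q ∈ Q, x ∉ starI q) →
    ∑ x ∈ W', ‖T b x‖ ^ 2 ≤ A * l ^ 2 * ∑ q ∈ Q, ((q.2:ℝ) - q.1 + 1)

/-- the `ℓ²` estimate -/
def HTwo {E F : Type} [NormedAddCommGroup E] [NormedAddCommGroup F] (A : ℝ)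
    (T : (ℤ → E) → (ℤ → F)) : Prop :=
  ∀ (W' W : Finset ℤ) (f : ℤ → E), (∀ x ∉ W, f x = 0) →
    ∑ x ∈ W', ‖T f x‖ ^ 2 ≤ A * ∑ x ∈ W, ‖f x‖ ^ 2

lemma cheb (W : Finset ℤ) (u : ℤ → ℝ) (l : ℝ) (hl : 0 < l) :
    ((W.filter (fun x => l < u x)).card : ℝ) * l ^ 2 ≤ ∑ x ∈ W, u x ^ 2 := by
  calc ((W.filter (fun x => l < u x)).card : ℝ) * l ^ 2
      = ∑ x ∈ W.filter (fun x => l < u x), l ^ 2 := by simp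
    _ ≤ ∑ x ∈ W.filter (fun x => l < u x), u x ^ 2 := by
        refine sum_le_sum fun x hx => ?_
        have := (mem_filter.1 hx).2
        gcongr
    _ ≤ _ := sum_le_sum_of_subset_of_nonneg (filter_subset _ _) fun x _ _ => sq_nonneg _

lemma IFam.sum_eq {Q : Finset (ℤ × ℤ)} (hQ : IFam Q) {M : Type*} [AddCommMonoid M] (Ω : Finset ℤ)
    (hΩ : ∀ x, x ∈ Ω ↔ ∃ q ∈ Q, x ∈ Icc q.1 q.2) (φ : ℤ → M) :
    ∑ x ∈ Ω, φ x = ∑ q ∈ Q, ∑ x ∈ Icc q.1 q.2, φ x := by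
  classical
  have : Ω = Q.biUnion (fun q => Icc q.1 q.2) := by
    ext x; rw [hΩ, mem_biUnion]
  rw [this, sum_biUnion]
  intro q hq q' hq' hne
  exact hQ.2 q hq q' hq' hne

lemma cz_level {E F : Type} [NormedAddCommGroup E] [NormedSpace ℝ E] [NormedAddCommGroup F]
    (A : ℝ) (hA : 0 ≤ A) (T : (ℤ → E) → (ℤ → F)) (hadd : ∀ f g, T (f + g) = T f + T g)
    (h2 : HTwo A T) (hoff : HOff A T) (W' W : Finset ℤ) (f : ℤ → E) (hf : ∀ x ∉ W, f x = 0)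
    (l : ℝ) (hl : 0 < l) :
    ((W'.filter (fun x => l < ‖T f x‖)).card : ℝ)
        ≤ (6 * (3 + 80 * A)) / l * ∑ x ∈ W.filter (fun x => l / 2 < ‖f x‖), ‖f x‖
          + (6 * (3 + 80 * A)) / l ^ 2 * ∑ x ∈ W.filter (fun x => ‖f x‖ ≤ l), ‖f x‖ ^ 2 := by
  classical
  set φ : ℤ → ℝ := fun x => ‖f x‖ with hφdef
  have hφ : ∀ x, 0 ≤ φ x := fun x => norm_nonneg _
  have hW : ∀ x ∉ W, φ x = 0 := fun x hx => by simp [hφdef, hf x hx]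
  set Ω : Finset ℤ := (bigSet_finite φ hφ W hW l hl).toFinset with hΩ
  have hΩm : ∀ x, x ∈ Ω ↔ x ∈ bigSet φ l := fun x => Set.Finite.mem_toFinset _
  have hΩc : (Ω.card : ℝ) ≤ 6 / l * ∑ x ∈ W.filter (fun x => l / 2 < φ x), φ x :=
    weak_two φ hφ W hW l hl Ω (fun x hx => (hΩm x).1 hx)
  have hΩn : ∀ x, x ∉ Ω → φ x ≤ l := by
    intro x hx
    by_contra hc
    push Not at hc
    exact hx ((hΩm x).2 ⟨x, x, le_rfl, le_rfl, by simpa using hc⟩)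
  obtain ⟨Q, hQ1, hQ2, hQ3, hQ4⟩ := int_decomp _ Ω rfl
  have hQ : IFam Q := ⟨hQ1, hQ3⟩
  have hlen : ∀ q ∈ Q, (1:ℝ) ≤ (q.2:ℝ) - q.1 + 1 := fun q hq => by
    have : (q.1:ℝ) ≤ q.2 := by exact_mod_cast hQ1 q hq
    linarith
  have hcard : ∀ q ∈ Q, ((Icc q.1 q.2).card : ℝ) = (q.2:ℝ) - q.1 + 1 := fun q hq =>
    icc_card_real _ _ (by have := hQ1 q hq; omega)
  have hΩcard : (Ω.card : ℝ) = ∑ q ∈ Q, ((q.2:ℝ) - q.1 + 1) := by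
    have := hQ.sum_eq Ω hQ4 (fun _ => (1:ℝ))
    simp only [sum_const, nsmul_eq_mul, mul_one] at this
    rw [this]
    exact sum_congr rfl hcard
  have hsumq : ∀ q ∈ Q, ∑ x ∈ Icc q.1 q.2, φ x ≤ 2 * l * ((q.2:ℝ) - q.1 + 1) := by
    intro q hq
    have h1 := hQ2 q hq
    rw [hΩm] at h1
    have h3 : ¬ (l * ((q.2:ℝ) - ((q.1 - 1 : ℤ):ℝ) + 1) < ∑ k ∈ Icc (q.1 - 1) q.2, φ k) := fun hc =>
      h1 ⟨q.1 - 1, q.2, le_rfl, by have := hQ1 q hq; omega, hc⟩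
    push Not at h3
    push_cast at h3
    have h4 : ∑ x ∈ Icc q.1 q.2, φ x ≤ ∑ k ∈ Icc (q.1 - 1) q.2, φ k :=
      sum_le_sum_of_subset_of_nonneg (Icc_subset_Icc (by omega) le_rfl) fun x _ _ => hφ x
    have := hlen q hq
    nlinarith
  set av : ℤ × ℤ → E := fun q => ((q.2:ℝ) - q.1 + 1)⁻¹ • ∑ x ∈ Icc q.1 q.2, f x with hav
  have havn : ∀ q ∈ Q, ‖av q‖ ≤ 2 * l := by
    intro q hq
    have h1 := hlen q hq
    rw [hav]
    simp only
    rw [norm_smul, norm_inv, Real.norm_of_nonneg (by linarith), inv_mul_le_iff₀ (by linarith)]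
    refine (norm_sum_le _ _).trans ((hsumq q hq).trans (le_of_eq (by ring)))
  set b : ℤ → E := fun x => ∑ q ∈ Q, if x ∈ Icc q.1 q.2 then f x - av q else 0 with hb
  have hbq : ∀ q ∈ Q, ∀ x ∈ Icc q.1 q.2, b x = f x - av q := by
    intro q hq x hx
    simp only [hb]
    rw [sum_eq_single q]
    · rw [if_pos hx]
    · intro q' hq' hne
      rw [if_neg]
      exact fun hx' => Finset.disjoint_left.1 (hQ3 q hq q' hq' hne.symm) hx hx'
    · exact fun h => absurd hq h
  have hbn : ∀ x, (∀ q ∈ Q, x ∉ Icc q.1 q.2) → b x = 0 := by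
    intro x hx
    simp only [hb]
    exact sum_eq_zero fun q hq => by rw [if_neg (hx q hq)]
  set g : ℤ → E := f - b with hg
  have hgb : f = g + b := by simp [hg]
  have hgq : ∀ q ∈ Q, ∀ x ∈ Icc q.1 q.2, g x = av q := by
    intro q hq x hx
    simp [hg, hbq q hq x hx]
  have hgn : ∀ x, x ∉ Ω → g x = f x := by
    intro x hx
    have : b x = 0 := hbn x fun q hq hxq => hx ((hQ4 x).2 ⟨q, hq, hxq⟩)
    simp [hg, this]
  have hgΩ : ∀ x ∈ Ω, ‖g x‖ ≤ 2 * l := by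
    intro x hx
    obtain ⟨q, hq, hxq⟩ := (hQ4 x).1 hx
    rw [hgq q hq x hxq]; exact havn q hq
  have hgsum : ∑ x ∈ W ∪ Ω, ‖g x‖ ^ 2 ≤
      ∑ x ∈ W.filter (fun x => φ x ≤ l), φ x ^ 2 + 4 * l ^ 2 * Ω.card := by
    have e : W ∪ Ω = (W \ Ω) ∪ Ω := by simp
    rw [e, sum_union sdiff_disjoint]
    gcongr ?_ + ?_
    · calc ∑ x ∈ W \ Ω, ‖g x‖ ^ 2 = ∑ x ∈ W \ Ω, φ x ^ 2 :=
            sum_congr rfl fun x hx => by rw [hgn x (mem_sdiff.1 hx).2]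
        _ ≤ _ := by
            apply sum_le_sum_of_subset_of_nonneg
            · intro x hx
              exact mem_filter.2 ⟨(mem_sdiff.1 hx).1, hΩn x (mem_sdiff.1 hx).2⟩
            · intros; positivity
    · calc ∑ x ∈ Ω, ‖g x‖ ^ 2 ≤ ∑ x ∈ Ω, (2 * l) ^ 2 := by
            refine sum_le_sum fun x hx => ?_
            have := hgΩ x hx
            gcongr
        _ = _ := by simp; ring
  have hTg := h2 W' (W ∪ Ω) g (fun x hx => by
    rw [mem_union, not_or] at hx
    rw [hgn x hx.2, hf x hx.1])
  set W'' := W'.filter (fun x => ∀ q ∈ Q, x ∉ starI q) with hW''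
  have hTb := hoff (4 * l) (by linarith) Q hQ b hbn
    (by
      intro q hq
      rw [sum_congr rfl (hbq q hq), sum_sub_distrib, sum_const, ← Nat.cast_smul_eq_nsmul ℝ,
        hcard q hq, hav]
      have := hlen q hq
      simp only
      rw [smul_inv_smul₀ (by linarith), sub_self])
    (by
      intro q hq
      rw [sum_congr rfl (fun x hx => by rw [hbq q hq x hx])]
      calc ∑ x ∈ Icc q.1 q.2, ‖f x - av q‖ ≤ ∑ x ∈ Icc q.1 q.2, (φ x + 2 * l) := by
            refine sum_le_sum fun x _ => (norm_sub_le _ _).trans ?_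
            have := havn q hq
            simp only [hφdef]; linarith
        _ ≤ _ := by
            rw [sum_add_distrib, sum_const, nsmul_eq_mul, hcard q hq]
            linarith [hsumq q hq])
    W'' (fun x hx => (mem_filter.1 hx).2)
  rw [← hΩcard] at hTb
  have c1 := cheb W' (fun x => ‖T g x‖) (l/2) (by linarith)
  have c2 := cheb W'' (fun x => ‖T b x‖) (l/2) (by linarith)
  have hsub : W'.filter (fun x => l < ‖T f x‖) ⊆ Q.biUnion starI ∪
      (W'.filter (fun x => l/2 < ‖T g x‖) ∪ W''.filter (fun x => l/2 < ‖T b x‖)) := by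
    intro x hx
    obtain ⟨hx, hxl⟩ := mem_filter.1 hx
    rw [mem_union, mem_union]
    by_cases hs : ∀ q ∈ Q, x ∉ starI q
    · right
      by_contra hc
      rw [not_or, mem_filter, mem_filter] at hc
      have h3 : ‖T g x‖ ≤ l/2 := by
        by_contra h; push Not at h; exact hc.1 ⟨hx, h⟩
      have h4 : ‖T b x‖ ≤ l/2 := by
        by_contra h; push Not at h; exact hc.2 ⟨mem_filter.2 ⟨hx, hs⟩, h⟩
      have : T f x = T g x + T b x := by
        conv_lhs => rw [hgb, hadd]
        rfl
      rw [this] at hxl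
      linarith [norm_add_le (T g x) (T b x)]
    · left
      push Not at hs
      obtain ⟨q, hq, hxq⟩ := hs
      exact mem_biUnion.2 ⟨q, hq, hxq⟩
  have hstar : ((Q.biUnion starI).card : ℝ) ≤ 3 * Ω.card := by
    calc ((Q.biUnion starI).card : ℝ) ≤ ∑ q ∈ Q, ((starI q).card : ℝ) := by
          exact_mod_cast card_biUnion_le
      _ = ∑ q ∈ Q, 3 * ((q.2:ℝ) - q.1 + 1) := by
          refine sum_congr rfl fun q hq => ?_
          have := hQ1 q hq
          rw [starI, icc_card_real _ _ (by omega)]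
          push_cast; ring
      _ = _ := by rw [← mul_sum, hΩcard]
  have hcount : ((W'.filter (fun x => l < ‖T f x‖)).card : ℝ) ≤ (Q.biUnion starI).card +
      ((W'.filter (fun x => l/2 < ‖T g x‖)).card + (W''.filter (fun x => l/2 < ‖T b x‖)).card) := by
    exact_mod_cast (card_le_card hsub).trans
      ((card_union_le _ _).trans (Nat.add_le_add_left (card_union_le _ _) _))
  set N1 : ℝ := ((W'.filter (fun x => l/2 < ‖T g x‖)).card : ℝ)
  set N2 : ℝ := ((W''.filter (fun x => l/2 < ‖T b x‖)).card : ℝ)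
  set S2 : ℝ := ∑ x ∈ W.filter (fun x => φ x ≤ l), φ x ^ 2 with hS2
  have hS2n : 0 ≤ S2 := by positivity
  set S1 : ℝ := ∑ x ∈ W.filter (fun x => l / 2 < φ x), φ x with hS1
  set w : ℝ := (Ω.card : ℝ)
  have hw : 0 ≤ w := Nat.cast_nonneg _
  have hl2 : 0 < l ^ 2 := by positivity
  have b1 : N1 ≤ 4 * A / l ^ 2 * S2 + 16 * A * w := by
    have h5 : N1 * (l/2)^2 ≤ A * (S2 + 4 * l ^ 2 * w) :=
      c1.trans (hTg.trans (mul_le_mul_of_nonneg_left hgsum hA))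
    have : N1 ≤ (4 * A * S2 + 16 * A * w * l ^ 2) / l ^ 2 := by
      rw [le_div_iff₀ hl2]; nlinarith
    refine this.trans (le_of_eq ?_)
    field_simp
  have b2 : N2 ≤ 64 * A * w := by
    have h5 : N2 * (l/2)^2 ≤ A * (4*l)^2 * w := c2.trans hTb
    have : N2 * l ^ 2 ≤ 64 * A * w * l ^ 2 := by nlinarith
    exact le_of_mul_le_mul_right this hl2
  have b3 : (3 + 80 * A) * w ≤ (6 * (3 + 80 * A)) / l * S1 := by
    calc (3 + 80 * A) * w ≤ (3 + 80 * A) * (6 / l * S1) :=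
          mul_le_mul_of_nonneg_left hΩc (by positivity)
      _ = _ := by ring
  have b4 : 4 * A / l ^ 2 * S2 ≤ (6 * (3 + 80 * A)) / l ^ 2 * S2 := by
    gcongr <;> linarith
  linarith

lemma cz_abstract (p A : ℝ) (hp1 : 1 < p) (hp2 : p < 2) (hA : 0 ≤ A) :
    ∃ C : ℝ, 0 < C ∧ ∀ (E F : Type) [NormedAddCommGroup E] [NormedSpace ℝ E]
      [NormedAddCommGroup F] (T : (ℤ → E) → (ℤ → F)), (∀ f g, T (f + g) = T f + T g) →
      HTwo A T → HOff A T → ∀ (W' W : Finset ℤ) (f : ℤ → E), (∀ x ∉ W, f x = 0) →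
      ∑ x ∈ W', ‖T f x‖ ^ p ≤ C * ∑ x ∈ W, ‖f x‖ ^ p := by
  obtain ⟨C, hC, H⟩ := lc_main p (6 * (3 + 80 * A)) hp1 hp2 (by positivity)
  refine ⟨C, hC, ?_⟩
  intro E F _ _ _ T hadd h2 hoff W' W f hf
  exact H W' W (fun x => ‖T f x‖) (fun x => ‖f x‖) (fun x => norm_nonneg _)
    (fun x => norm_nonneg _) (fun l hl => cz_level A hA T hadd h2 hoff W' W f hf l hl)


/-- averaging kernel -/
noncomputable def vker (n e : ℕ) : ℝ := if e ≤ n then 1 / (2 * (n:ℝ) + 1) else 0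

/-- averages on the integers -/
noncomputable def zavg (n : ℕ) (f : ℤ → ℝ) (x : ℤ) : ℝ :=
  (∑ k ∈ Icc (-(n:ℤ)) n, f (x + k)) / (2 * (n:ℝ) + 1)

lemma zavg_add (n : ℕ) (f g : ℤ → ℝ) (x : ℤ) : zavg n (f + g) x = zavg n f x + zavg n g x := by
  simp [zavg, sum_add_distrib, add_div]

lemma zavg_eq (n : ℕ) (f : ℤ → ℝ) (W : Finset ℤ) (hf : ∀ x ∉ W, f x = 0) (x : ℤ) :
    zavg n f x = ∑ k ∈ W, f k * vker n (k - x).natAbs := by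
  have h1 : ∑ k ∈ Icc (-(n:ℤ)) n, f (x + k) = ∑ k ∈ Icc (x - n) (x + n), f k := by
    apply sum_bij (fun k _ => x + k)
    · intro k hk; rw [mem_Icc] at *; omega
    · intro k _ k' _ h; omega
    · intro k hk; rw [mem_Icc] at hk; exact ⟨k - x, by rw [mem_Icc]; omega, by omega⟩
    · intros; rfl
  have h2 : ∑ k ∈ Icc (x - n) (x + n), f k = ∑ k ∈ W, if (k - x).natAbs ≤ n then f k else 0 := by
    rw [← sum_filter]
    symm
    apply sum_subset_zero_on_sdiff
    · intro k hk
      have := (mem_filter.1 hk).2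
      rw [mem_Icc]; omega
    · intro k hk
      rw [mem_sdiff, mem_Icc, mem_filter] at hk
      apply hf
      intro hkW
      exact hk.2 ⟨hkW, by omega⟩
    · intros; rfl
  rw [zavg, h1, h2, sum_div]
  refine sum_congr rfl fun k _ => ?_
  unfold vker
  split_ifs <;> simp [div_eq_mul_inv]

lemma vker_var (n : ℕ → ℕ) (hn : StrictMono n) (e : ℕ) (N : ℕ) :
    ∑ i ∈ range N, |vker (n i) e - vker (n (i+1)) e| ≤ 
      if e ≤ n N then 2 / (2 * (e:ℝ) + 1) - vker (n N) e else 0 := by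
  have hv : ∀ m : ℕ, e ≤ m → 1 / (2 * (m:ℝ) + 1) ≤ 1 / (2 * (e:ℝ) + 1) := by
    intro m hm
    have : (e:ℝ) ≤ m := by exact_mod_cast hm
    gcongr
  have h2e : 2 / (2 * (e:ℝ) + 1) = 2 * (1 / (2 * (e:ℝ) + 1)) := by ring
  induction N with
  | zero =>
    simp only [range_zero, sum_empty]
    split_ifs with h
    · have := hv _ h
      have h3 : 0 ≤ 1 / (2 * (e:ℝ) + 1) := by positivity
      rw [vker, if_pos h, h2e]; linarith
    · exact le_rfl
  | succ N ih =>
    rw [sum_range_succ]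
    have hlt : n N < n (N+1) := hn (Nat.lt_succ_self N)
    by_cases h : e ≤ n N
    · have h' : e ≤ n (N+1) := h.trans hlt.le
      rw [if_pos h] at ih
      rw [if_pos h']
      have : vker (n (N+1)) e ≤ vker (n N) e := by
        rw [vker, vker, if_pos h, if_pos h']
        have : (n N:ℝ) ≤ n (N+1) := by exact_mod_cast hlt.le
        gcongr
      rw [abs_of_nonneg (by linarith)]
      linarith
    · rw [if_neg h] at ih
      have h0 : vker (n N) e = 0 := by rw [vker, if_neg h]
      rw [h0, zero_sub, abs_neg]
      by_cases h' : e ≤ n (N+1)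
      · rw [if_pos h']
        have hv1 : vker (n (N+1)) e = 1 / (2 * (n (N+1):ℝ) + 1) := by rw [vker, if_pos h']
        have h3 : 0 ≤ vker (n (N+1)) e := by rw [hv1]; positivity
        rw [abs_of_nonneg h3]
        have := hv _ h'
        rw [h2e]; linarith
      · rw [if_neg h', vker, if_neg h']; simpa using ih

lemma vker_var' (n : ℕ → ℕ) (hn : StrictMono n) (e : ℕ) (N : ℕ) :
    ∑ i ∈ range N, |vker (n i) e - vker (n (i+1)) e| ≤ 2 / (2 * (e:ℝ) + 1) := by
  refine (vker_var n hn e N).trans ?_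
  split_ifs with h
  · rw [vker, if_pos h]
    have : 0 ≤ 1 / (2 * (n N:ℝ) + 1) := by positivity
    linarith
  · positivity

lemma var_sum (n : ℕ → ℕ) (hn : StrictMono n) (N : ℕ) (S : Finset ℤ) (h : ℤ → ℝ) (e : ℤ → ℕ) :
    ∑ i ∈ range N, |∑ k ∈ S, h k * vker (n i) (e k) - ∑ k ∈ S, h k * vker (n (i+1)) (e k)|
      ≤ ∑ k ∈ S, |h k| * (2 / (2 * (e k:ℝ) + 1)) := by
  calc _ ≤ ∑ i ∈ range N, ∑ k ∈ S, |h k| * |vker (n i) (e k) - vker (n (i+1)) (e k)| := by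
        refine sum_le_sum fun i _ => ?_
        rw [← sum_sub_distrib]
        refine (abs_sum_le_sum_abs _ _).trans (sum_le_sum fun k _ => ?_)
        rw [← mul_sub, abs_mul]
    _ = ∑ k ∈ S, |h k| * ∑ i ∈ range N, |vker (n i) (e k) - vker (n (i+1)) (e k)| := by
        rw [sum_comm]; simp only [mul_sum]
    _ ≤ _ := by
        gcongr with k _
        exact vker_var' n hn _ N

/-- pieces with bounded overlap -/
lemma pieces {J : Type*} [DecidableEq J] (J0 : Finset J) (c : J → ℕ → ℝ) (r : ℕ) (n : ℕ → ℕ) (N : ℕ)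
    (hr : ∀ m, (J0.filter (fun j => c j m ≠ 0)).card ≤ r) :
    ∑ i ∈ range N, (∑ j ∈ J0, c j (n i) - ∑ j ∈ J0, c j (n (i+1))) ^ 2
      ≤ (2 * r : ℕ) * ∑ j ∈ J0, (∑ i ∈ range N, |c j (n i) - c j (n (i+1))|) ^ 2 := by
  calc _ ≤ ∑ i ∈ range N, (2 * r : ℕ) * ∑ j ∈ J0, |c j (n i) - c j (n (i+1))| ^ 2 := by
        refine sum_le_sum fun i _ => ?_
        set J1 := J0.filter (fun j => c j (n i) ≠ 0) ∪ J0.filter (fun j => c j (n (i+1)) ≠ 0)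
        have hsub : J1 ⊆ J0 := union_subset (filter_subset _ _) (filter_subset _ _)
        have hc : J1.card ≤ 2 * r := by
          have h1 := hr (n i)
          have h2 := hr (n (i+1))
          refine (card_union_le _ _).trans ?_
          omega
        have e1 : ∑ j ∈ J0, c j (n i) - ∑ j ∈ J0, c j (n (i+1))
            = ∑ j ∈ J1, (c j (n i) - c j (n (i+1))) := by
          rw [← sum_sub_distrib]
          symm
          apply sum_subset hsub
          intro j hj hj1
          simp only [J1, mem_union, mem_filter, not_or, not_and, not_not] at hj1
          rw [hj1.1 hj, hj1.2 hj, sub_zero]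
        rw [e1]
        refine sq_sum_le_card_mul_sum_sq.trans ?_
        have h3 : ∑ j ∈ J1, (c j (n i) - c j (n (i+1))) ^ 2
            ≤ ∑ j ∈ J0, |c j (n i) - c j (n (i+1))| ^ 2 := by
          simp only [sq_abs]
          exact sum_le_sum_of_subset_of_nonneg hsub fun _ _ _ => sq_nonneg _
        have h4 : (J1.card : ℝ) ≤ (2 * r : ℕ) := by exact_mod_cast hc
        have h5 : 0 ≤ ∑ j ∈ J1, (c j (n i) - c j (n (i+1))) ^ 2 := sum_nonneg fun _ _ => sq_nonneg _
        exact mul_le_mul h4 h3 h5 (by positivity)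
    _ = (2 * r : ℕ) * ∑ j ∈ J0, ∑ i ∈ range N, |c j (n i) - c j (n (i+1))| ^ 2 := by
        rw [← mul_sum, sum_comm]
    _ ≤ _ := by
        gcongr with j _
        exact sum_sq_le_sq_sum_of_nonneg fun _ _ => abs_nonneg _

/-- the vector valued operator -/
noncomputable def SQ (n : ℕ → ℕ) (N : ℕ) (f : ℤ → ℝ) (x : ℤ) : EuclideanSpace ℝ (Fin N) :=
  WithLp.toLp 2 fun i => zavg (n i) f x - zavg (n (i + 1)) f x

/-- its adjoint -/
noncomputable def SA (n : ℕ → ℕ) (N : ℕ) (g : ℤ → EuclideanSpace ℝ (Fin N)) (x : ℤ) : ℝ :=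
  ∑ i : Fin N, (zavg (n i) (fun y => g y i) x - zavg (n (i + 1)) (fun y => g y i) x)

lemma SQ_norm_sq (n : ℕ → ℕ) (N : ℕ) (f : ℤ → ℝ) (x : ℤ) :
    ‖SQ n N f x‖ ^ 2 = ∑ i ∈ range N, (zavg (n i) f x - zavg (n (i+1)) f x) ^ 2 := by
  rw [EuclideanSpace.real_norm_sq_eq, ← Fin.sum_univ_eq_sum_range
    (fun i => (zavg (n i) f x - zavg (n (i+1)) f x) ^ 2)]
  rfl

lemma SQ_add (n : ℕ → ℕ) (N : ℕ) (f g : ℤ → ℝ) : SQ n N (f + g) = SQ n N f + SQ n N g := by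
  ext x i
  simp [SQ, zavg_add]; ring

lemma SA_add (n : ℕ → ℕ) (N : ℕ) (f g : ℤ → EuclideanSpace ℝ (Fin N)) :
    SA n N (f + g) = SA n N f + SA n N g := by
  ext x
  simp only [SA, Pi.add_apply, ← sum_add_distrib]
  refine sum_congr rfl fun i _ => ?_
  have : ∀ m, zavg m (fun y => (f y + g y) i) x = zavg m (fun y => f y i) x + zavg m (fun y => g y i) x :=
    fun m => zavg_add m (fun y => f y i) (fun y => g y i) x
  rw [this, this]; ring

/-- duality -/
lemma SQ_SA (n : ℕ → ℕ) (N : ℕ) (W V : Finset ℤ) (h : ℤ → ℝ) (g : ℤ → EuclideanSpace ℝ (Fin N))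
    (hh : ∀ x ∉ W, h x = 0) (hg : ∀ x ∉ V, g x = 0) :
    ∑ x ∈ W, h x * SA n N g x = ∑ y ∈ V, inner ℝ (g y) (SQ n N h y) := by
  have e : ∀ (m : ℕ) (i : Fin N), ∑ x ∈ W, h x * zavg m (fun y => g y i) x
      = ∑ y ∈ V, g y i * zavg m h y := by
    intro m i
    have h1 : ∀ x, zavg m (fun y => g y i) x = ∑ k ∈ V, g k i * vker m (k - x).natAbs := fun x =>
      zavg_eq m _ V (fun y hy => by simp [hg y hy]) x
    have h2 : ∀ y, zavg m h y = ∑ k ∈ W, h k * vker m (k - y).natAbs := fun x =>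
      zavg_eq m _ W hh x
    simp only [h1, h2, mul_sum]
    rw [sum_comm]
    refine sum_congr rfl fun y _ => sum_congr rfl fun x _ => ?_
    rw [show (y - x).natAbs = (x - y).natAbs by omega]
    ring
  have e2 : ∀ y, inner ℝ (g y) (SQ n N h y) =
      ∑ i : Fin N, (g y i * zavg (n i) h y - g y i * zavg (n (i+1)) h y) := by
    intro y
    rw [PiLp.inner_apply]
    refine sum_congr rfl fun i _ => ?_
    simp [SQ]; ring
  simp only [e2, SA, mul_sum, mul_sub]
  rw [sum_comm, sum_comm (s := V)]
  refine sum_congr rfl fun i _ => ?_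
  rw [sum_sub_distrib, sum_sub_distrib, e, e]


/-- Dirichlet sum -/
noncomputable def dsum (z : ℂ) (n : ℕ) : ℂ := ∑ k ∈ Icc (-(n:ℤ)) n, z ^ k
/-- normalized Dirichlet sum -/
noncomputable def dker (z : ℂ) (n : ℕ) : ℂ := dsum z n / (2 * (n:ℂ) + 1)

lemma dsum_succ (z : ℂ) (n : ℕ) :
    dsum z (n+1) = dsum z n + (z ^ ((n:ℤ)+1) + z ^ (-((n:ℤ)+1))) := by
  have : Icc (-((n+1:ℕ):ℤ)) ((n+1:ℕ):ℤ)
      = insert (-((n:ℤ)+1)) (insert ((n:ℤ)+1) (Icc (-(n:ℤ)) n)) := by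
    ext x; simp only [mem_insert, mem_Icc]; push_cast; omega
  rw [dsum, this, sum_insert, sum_insert, dsum]
  · ring
  · simp
  · simp only [mem_insert, mem_Icc]; omega

lemma dsum_mul (z : ℂ) (hz : z ≠ 0) (n : ℕ) :
    dsum z n * (z - 1) = z ^ ((n:ℤ)+1) - z ^ (-(n:ℤ)) := by
  induction n with
  | zero => simp [dsum]
  | succ n ih =>
    rw [dsum_succ, add_mul, ih]
    have e1 : z ^ (((n+1:ℕ):ℤ)+1) = z ^ ((n:ℤ)+1) * z := by
      rw [← zpow_add_one₀ hz]; push_cast; rfl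
    have e2 : z ^ (-(n:ℤ)) = z ^ (-((n:ℤ)+1)) * z := by
      rw [← zpow_add_one₀ hz]; congr 1; ring
    rw [e1, e2]; push_cast; ring

lemma pow_sub_one_le (z : ℂ) (hz : ‖z‖ = 1) (n : ℕ) : ‖z ^ n - 1‖ ≤ n * ‖z - 1‖ := by
  induction n with
  | zero => simp
  | succ n ih =>
    have : z ^ (n+1) - 1 = z ^ n * (z - 1) + (z ^ n - 1) := by ring
    rw [this]
    refine (norm_add_le _ _).trans ?_
    rw [norm_mul, norm_pow, hz, one_pow]; push_cast; linarith

lemma zpow_sub_one_le (z : ℂ) (hz : ‖z‖ = 1) (k : ℤ) : ‖z ^ k - 1‖ ≤ k.natAbs * ‖z - 1‖ := by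
  have hz0 : z ≠ 0 := by rintro rfl; simp at hz
  rcases Int.natAbs_eq k with h | h
  · conv_lhs => rw [h]
    rw [zpow_natCast]; exact pow_sub_one_le z hz _
  · conv_lhs => rw [h]
    rw [zpow_neg, zpow_natCast]
    have : (z ^ k.natAbs)⁻¹ - 1 = - ((z ^ k.natAbs)⁻¹ * (z ^ k.natAbs - 1)) := by
      have : z ^ k.natAbs ≠ 0 := pow_ne_zero _ hz0
      field_simp; ring
    rw [this, norm_neg, norm_mul, norm_inv, norm_pow, hz]
    rw [one_pow, inv_one, one_mul]; exact pow_sub_one_le z hz _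

lemma dcast (n : ℕ) : (2 * (n:ℂ) + 1) = ((2 * (n:ℝ) + 1 : ℝ) : ℂ) := by push_cast; rfl
lemma dcast_ne (n : ℕ) : (2 * (n:ℂ) + 1) ≠ 0 := by
  rw [dcast]; exact_mod_cast (by positivity : (2 * (n:ℝ) + 1) ≠ 0)
lemma dcast_norm (n : ℕ) : ‖(2 * (n:ℂ) + 1)‖ = 2 * (n:ℝ) + 1 := by
  rw [dcast, Complex.norm_real, Real.norm_of_nonneg (by positivity)]

lemma icc_card (n : ℕ) : ((Icc (-(n:ℤ)) n).card : ℝ) = 2 * (n:ℝ) + 1 := by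
  rw [icc_card_real _ _ (by omega)]; push_cast; ring

lemma dker_le_one (z : ℂ) (hz : ‖z‖ = 1) (n : ℕ) : ‖dker z n‖ ≤ 1 := by
  rw [dker, norm_div, dcast_norm, div_le_one (by positivity), ← icc_card]
  refine (norm_sum_le _ _).trans ?_
  simp [norm_zpow, hz]

lemma dker_decay (z : ℂ) (hz : ‖z‖ = 1) (n : ℕ) :
    (2 * (n:ℝ) + 1) * ‖z - 1‖ * ‖dker z n‖ ≤ 2 := by
  have hz0 : z ≠ 0 := by rintro rfl; simp at hz
  have h := congrArg norm (dsum_mul z hz0 n)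
  rw [norm_mul] at h
  have h2 : ‖z ^ ((n:ℤ)+1) - z ^ (-(n:ℤ))‖ ≤ 2 := by
    refine (norm_sub_le _ _).trans ?_
    rw [norm_zpow, norm_zpow, hz]; norm_num
  rw [dker, norm_div, dcast_norm]
  have : (2 * (n:ℝ) + 1) ≠ 0 := by positivity
  field_simp
  linarith

lemma dker_sub_one (z : ℂ) (hz : ‖z‖ = 1) (n : ℕ) : ‖dker z n - 1‖ ≤ n * ‖z - 1‖ := by
  have e : dker z n - 1 = (∑ k ∈ Icc (-(n:ℤ)) n, (z ^ k - 1)) / (2 * (n:ℂ) + 1) := by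
    have hc : ((Icc (-(n:ℤ)) n).card : ℂ) = 2 * (n:ℂ) + 1 := by
      rw [dcast]; exact_mod_cast congrArg ((↑) : ℝ → ℂ) (icc_card n)
    rw [sum_sub_distrib, sum_const, nsmul_eq_mul, mul_one, hc, sub_div, div_self (dcast_ne n)]; rfl
  rw [e, norm_div, dcast_norm, div_le_iff₀ (by positivity)]
  calc _ ≤ ∑ k ∈ Icc (-(n:ℤ)) n, ‖z ^ k - 1‖ := norm_sum_le _ _
    _ ≤ ∑ k ∈ Icc (-(n:ℤ)) n, n * ‖z - 1‖ := by
        refine sum_le_sum fun k hk => (zpow_sub_one_le z hz k).trans ?_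
        rw [mem_Icc] at hk
        have : k.natAbs ≤ n := by omega
        gcongr
    _ = _ := by rw [sum_const, nsmul_eq_mul, icc_card]; ring

lemma dker_diff (z : ℂ) (hz : ‖z‖ = 1) (n : ℕ) :
    (2 * (n:ℝ) + 3) * ‖dker z n - dker z (n+1)‖ ≤ 4 ∧ ‖dker z n - dker z (n+1)‖ ≤ 2 * ‖z - 1‖ := by
  have e : (2 * ((n+1:ℕ):ℂ) + 1) * (dker z n - dker z (n+1))
      = 2 * dker z n - (z ^ ((n:ℤ)+1) + z ^ (-((n:ℤ)+1))) := by
    have h1 : (2 * ((n+1:ℕ):ℂ) + 1) * dker z (n+1) = dsum z (n+1) := by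
      rw [dker, mul_div_cancel₀ _ (dcast_ne _)]
    have h2 : (2 * (n:ℂ) + 1) * dker z n = dsum z n := by
      rw [dker, mul_div_cancel₀ _ (dcast_ne _)]
    rw [mul_sub, h1, dsum_succ, ← h2]; push_cast; ring
  have en := congrArg norm e
  rw [norm_mul, dcast_norm] at en
  have e3 : 2 * (((n+1:ℕ):ℝ)) + 1 = 2 * (n:ℝ) + 3 := by push_cast; ring
  rw [e3] at en
  constructor
  · rw [en]
    refine (norm_sub_le _ _).trans ?_
    have h1 := norm_add_le (z ^ ((n:ℤ)+1)) (z ^ (-((n:ℤ)+1)))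
    rw [norm_zpow, norm_zpow, hz, one_zpow, one_zpow] at h1
    have h2 := dker_le_one z hz n
    rw [norm_mul, Complex.norm_ofNat]
    linarith
  · have h4 : 2 * dker z n - (z ^ ((n:ℤ)+1) + z ^ (-((n:ℤ)+1)))
        = 2 * (dker z n - 1) - ((z ^ ((n:ℤ)+1) - 1) + (z ^ (-((n:ℤ)+1)) - 1)) := by ring
    rw [h4] at en
    have h5 := norm_sub_le (2 * (dker z n - 1)) ((z ^ ((n:ℤ)+1) - 1) + (z ^ (-((n:ℤ)+1)) - 1))
    have h6 := norm_add_le (z ^ ((n:ℤ)+1) - 1) (z ^ (-((n:ℤ)+1)) - 1)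
    have h7 := zpow_sub_one_le z hz ((n:ℤ)+1)
    have h8 := zpow_sub_one_le z hz (-((n:ℤ)+1))
    have h9 := dker_sub_one z hz n
    rw [norm_mul, Complex.norm_ofNat] at h5
    have a1 : (((n:ℤ)+1).natAbs : ℝ) = n + 1 := by
      rw [show ((n:ℤ)+1).natAbs = n + 1 by omega]; push_cast; rfl
    have a2 : ((-((n:ℤ)+1)).natAbs : ℝ) = n + 1 := by
      rw [show (-((n:ℤ)+1)).natAbs = n + 1 by omega]; push_cast; rfl
    rw [a1] at h7
    rw [a2] at h8
    have ht := norm_nonneg (z - 1)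
    have h10 : (2 * (n:ℝ) + 3) * ‖dker z n - dker z (n+1)‖ ≤ (2 * (n:ℝ) + 3) * (2 * ‖z - 1‖) := by
      rw [en]; nlinarith
    exact le_of_mul_le_mul_left h10 (by positivity)

lemma dker_tele (z : ℂ) (c : ℝ) (n : ℕ) (d : ℕ)
    (h : ∀ j, n ≤ j → ‖dker z j - dker z (j+1)‖ ≤ c) : ‖dker z n - dker z (n+d)‖ ≤ d * c := by
  induction d with
  | zero => simp
  | succ d ih =>
    have := h (n+d) (by omega)
    have h2 : dker z n - dker z (n+(d+1)) = (dker z n - dker z (n+d)) + (dker z (n+d) - dker z (n+d+1)) := by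
      rw [← add_assoc]; ring
    rw [h2]
    refine (norm_add_le _ _).trans ?_
    push_cast; linarith

/-- potential function -/
noncomputable def psiP (t : ℝ) (n : ℕ) : ℝ := if n * t ≤ 1 then 4 * (n * t) else 16 - 8 / (n * t)

lemma dker_pot (z : ℂ) (hz : ‖z‖ = 1) (n m : ℕ) (hn : 0 < n) (hnm : n < m) :
    ‖dker z n - dker z m‖ ^ 2 ≤ psiP ‖z - 1‖ m - psiP ‖z - 1‖ n := by
  obtain ⟨d, rfl⟩ := Nat.exists_eq_add_of_lt hnm
  rw [add_assoc]
  set D := d + 1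
  set t := ‖z - 1‖ with ht
  have ht0 : 0 ≤ t := norm_nonneg _
  have hnr : (1:ℝ) ≤ n := by exact_mod_cast hn
  have hD : (1:ℝ) ≤ D := by simp [D]
  have hcast : ((n + D : ℕ) : ℝ) = n + D := by push_cast; rfl
  set u := ‖dker z n - dker z (n+D)‖ with hu
  have hu0 : 0 ≤ u := norm_nonneg _
  have u1 : u ≤ D * (2 * t) := dker_tele z _ n D fun j _ => (dker_diff z hz j).2
  have u2 : u ≤ D * (2 / n) := dker_tele z _ n D fun j hj => by
    have h1 := (dker_diff z hz j).1
    have hjn : (n:ℝ) ≤ j := by exact_mod_cast hj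
    rw [le_div_iff₀ (by linarith)]
    have := norm_nonneg (dker z j - dker z (j+1))
    nlinarith
  have u3 : u ≤ 2 := by
    refine (norm_sub_le _ _).trans ?_
    linarith [dker_le_one z hz n, dker_le_one z hz (n+D)]
  rw [psiP, psiP, hcast]
  have hDn : (n:ℝ) * t ≤ (n + D) * t := by nlinarith
  split_ifs with h1 h2 h2
  · -- both small
    have : u ^ 2 ≤ 2 * u := by nlinarith
    nlinarith
  · exfalso; linarith
  · push Not at h1
    have : 8 / (((n:ℝ) + D) * t) ≤ 8 := by
      rw [div_le_iff₀ (by linarith)]; linarith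
    nlinarith
  · push Not at h1 h2
    have htpos : 0 < t := by
      rcases ht0.eq_or_lt with h | h
      · rw [← h] at h2; simp at h2; linarith
      · exact h
    have hnt : 0 < (n:ℝ) * t := by positivity
    -- decay
    have d1 : ‖dker z n‖ ≤ 1 / (n * t) := by
      rw [le_div_iff₀ hnt]
      have := dker_decay z hz n
      have h0 := mul_nonneg ht0 (norm_nonneg (dker z n))
      nlinarith
    have d2 : ‖dker z (n+D)‖ ≤ 1 / (n * t) := by
      rw [le_div_iff₀ hnt]
      have := dker_decay z hz (n+D)
      rw [hcast] at this
      have h0 := mul_nonneg ht0 (norm_nonneg (dker z (n+D)))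
      nlinarith
    have u4 : u ≤ 2 / (n * t) := by
      refine (norm_sub_le _ _).trans ?_
      have : 2 / ((n:ℝ) * t) = 1 / (n*t) + 1/(n*t) := by ring
      linarith
    have e : 16 - 8 / ((↑n + ↑D) * t) - (16 - 8 / (↑n * t)) = 8 * D / (n * (n + D) * t) := by
      field_simp; ring
    rw [e]
    rw [le_div_iff₀ hnt] at u4
    rw [le_div_iff₀ (by positivity)]
    by_cases hDn' : (D:ℝ) ≤ n
    · have u5 : u * n ≤ D * 2 := by
        rw [← le_div_iff₀ (by linarith)]; refine u2.trans (le_of_eq (by ring))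
      -- combine the three bounds
      have h3 : (u * (n * t)) * (u * n) ≤ 2 * (D * 2) :=
        mul_le_mul u4 u5 (by positivity) (by norm_num)
      have h4 : u ^ 2 * (n * (n + D) * t) ≤ u ^ 2 * (n * (n + n) * t) := by gcongr
      nlinarith
    · push Not at hDn'
      have h3 : (u * (n * t)) * (u * (n*t)) ≤ 2 * 2 :=
        mul_le_mul u4 u4 (by positivity) (by norm_num)
      have h5 : u ^ 2 * (n * t) ≤ 4 := by
        have : u ^ 2 * (n * t) * 1 ≤ u ^ 2 * (n * t) * (n * t) := by gcongr
        nlinarith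
      calc u ^ 2 * (n * (n + D) * t) = (u ^ 2 * (n * t)) * ((n:ℝ) + D) := by ring
        _ ≤ (4:ℝ) * ((n:ℝ) + D) := by gcongr
        _ ≤ 8 * (D:ℝ) := by linarith

lemma dker_square (z : ℂ) (hz : ‖z‖ = 1) (n : ℕ → ℕ) (hn : StrictMono n) (hn0 : ∀ i, 0 < n i) (N : ℕ) :
    ∑ i ∈ range N, ‖dker z (n i) - dker z (n (i+1))‖ ^ 2 ≤ 16 := by
  have h1 : ∑ i ∈ range N, ‖dker z (n i) - dker z (n (i+1))‖ ^ 2 ≤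
      ∑ i ∈ range N, (psiP ‖z - 1‖ (n (i+1)) - psiP ‖z - 1‖ (n i)) :=
    sum_le_sum fun i _ => dker_pot z hz _ _ (hn0 i) (hn (Nat.lt_succ_self i))
  rw [sum_range_sub (fun i => psiP ‖z - 1‖ (n i))] at h1
  have h2 : psiP ‖z-1‖ (n N) ≤ 16 := by
    unfold psiP
    split_ifs with h
    · linarith
    · have : 0 ≤ 8 / ((n N : ℝ) * ‖z - 1‖) := by positivity
      linarith
  have h3 : 0 ≤ psiP ‖z-1‖ (n 0) := by
    unfold psiP
    split_ifs with h
    · positivity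
    · push Not at h
      have : 8 / ((n 0 : ℝ) * ‖z - 1‖) ≤ 8 := by
        rw [div_le_iff₀ (by linarith)]; linarith
      linarith
  linarith


/-- the point on the circle -/
noncomputable def circ (θ : ℝ) : ℂ := Complex.exp (θ * Complex.I)

lemma circ_norm (θ : ℝ) : ‖circ θ‖ = 1 := Complex.norm_exp_ofReal_mul_I θ
lemma circ_ne (θ : ℝ) : circ θ ≠ 0 := Complex.exp_ne_zero _

lemma circ_cont (k : ℤ) : Continuous fun θ : ℝ => circ θ ^ k := by
  have : (fun θ : ℝ => circ θ ^ k) = fun θ : ℝ => Complex.exp (k * (θ * Complex.I)) := by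
    ext θ; rw [circ, Complex.exp_int_mul]
  rw [this]; fun_prop

lemma circ_int (k : ℤ) : ∫ θ in (0:ℝ)..(2 * Real.pi), circ θ ^ k = if k = 0 then (2 * Real.pi : ℂ) else 0 := by
  split_ifs with h
  · subst h; simp
  · have : (fun θ : ℝ => circ θ ^ k) = fun θ : ℝ => Complex.exp ((k * Complex.I) * θ) := by
      ext θ; rw [circ, ← Complex.exp_int_mul]; congr 1; ring
    rw [this, integral_exp_mul_complex (by simp [h])]
    have h2 : Complex.exp (k * Complex.I * ((2 * Real.pi : ℝ) : ℂ)) = 1 := by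
      rw [Complex.exp_eq_one_iff]; exact ⟨k, by push_cast; ring⟩
    rw [h2]; simp

lemma parseval (W : Finset ℤ) (c : ℤ → ℂ) :
    ∫ θ in (0:ℝ)..(2 * Real.pi), ‖∑ k ∈ W, c k * circ θ ^ k‖ ^ 2 = 2 * Real.pi * ∑ k ∈ W, ‖c k‖ ^ 2 := by
  have h1 : ∀ θ : ℝ, ((‖∑ k ∈ W, c k * circ θ ^ k‖ ^ 2 : ℝ) : ℂ)
      = ∑ j ∈ W, ∑ k ∈ W, c j * (starRingEnd ℂ) (c k) * circ θ ^ (j - k) := by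
    intro θ
    rw [Complex.ofReal_pow, ← Complex.mul_conj', map_sum, sum_mul_sum]
    refine sum_congr rfl fun j _ => sum_congr rfl fun k _ => ?_
    have : (starRingEnd ℂ) (circ θ) = (circ θ)⁻¹ := by
      rw [Complex.inv_def, Complex.normSq_eq_norm_sq, circ_norm]; simp
    rw [map_mul, map_zpow₀, this, inv_zpow, zpow_sub₀ (circ_ne θ), div_eq_mul_inv]
    ring
  have h2 : ((∫ θ in (0:ℝ)..(2 * Real.pi), ‖∑ k ∈ W, c k * circ θ ^ k‖ ^ 2 : ℝ) : ℂ)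
      = ((2 * Real.pi * ∑ k ∈ W, ‖c k‖ ^ 2 : ℝ) : ℂ) := by
    rw [← intervalIntegral.integral_ofReal]
    simp only [h1]
    have hi : ∀ j k, IntervalIntegrable (fun θ : ℝ => c j * (starRingEnd ℂ) (c k) * circ θ ^ (j - k))
        volume 0 (2 * Real.pi) := fun j k =>
      ((circ_cont _).const_mul _).intervalIntegrable _ _
    rw [intervalIntegral.integral_finsetSum (fun j _ => 
      (continuous_finsetSum _ fun k _ => ((circ_cont _).const_mul _)).intervalIntegrable _ _)]
    push_cast
    rw [mul_sum]
    refine sum_congr rfl fun j hj => ?_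
    rw [intervalIntegral.integral_finsetSum (fun k _ => hi j k)]
    rw [sum_eq_single j]
    · rw [intervalIntegral.integral_const_mul, circ_int, if_pos (by ring), Complex.mul_conj']
      ring
    · intro k _ hk
      rw [intervalIntegral.integral_const_mul, circ_int, if_neg (by omega), mul_zero]
    · exact fun h => absurd hj h
  exact_mod_cast h2

lemma zavg_fourier (m : ℕ) (f : ℤ → ℝ) (W V : Finset ℤ) (hf : ∀ x ∉ W, f x = 0)
    (hV : ∀ y ∈ W, ∀ x ∈ Icc (y - m) (y + m), x ∈ V) (z : ℂ) (hz : z ≠ 0) :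
    ∑ x ∈ V, (zavg m f x : ℂ) * z ^ x = (∑ y ∈ W, (f y : ℂ) * z ^ y) * dker z m := by
  have h1 : ∀ x, (zavg m f x : ℂ) = ∑ k ∈ W, (f k : ℂ) * (vker m (k - x).natAbs : ℂ) := by
    intro x; rw [zavg_eq m f W hf x]; push_cast; rfl
  simp only [h1, sum_mul]
  rw [sum_comm]
  refine sum_congr rfl fun y hy => ?_
  have h2 : ∑ x ∈ V, (f y : ℂ) * (vker m (y - x).natAbs : ℂ) * z ^ x
      = ∑ x ∈ Icc (y - m) (y + m), (f y : ℂ) * (1 / (2 * (m:ℂ) + 1)) * z ^ x := by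
    symm
    apply sum_subset_zero_on_sdiff (hV y hy)
    · intro x hx
      rw [mem_sdiff, mem_Icc] at hx
      rw [vker, if_neg (by omega)]; simp
    · intro x hx
      rw [mem_Icc] at hx
      rw [vker, if_pos (by omega)]; push_cast; rfl
  rw [h2, dker, dsum, ← mul_sum]
  have h3 : ∑ x ∈ Icc (y - m) (y + m), z ^ x = ∑ k ∈ Icc (-(m:ℤ)) m, z ^ y * z ^ k := by
    symm
    apply sum_bij (fun k _ => y + k)
    · intro k hk; rw [mem_Icc] at *; omega
    · intro k _ k' _ h; omega
    · intro k hk; rw [mem_Icc] at hk; exact ⟨k - y, by rw [mem_Icc]; omega, by omega⟩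
    · intro k _; rw [zpow_add₀ hz]
  rw [h3, ← mul_sum]; ring

lemma SQ_two (n : ℕ → ℕ) (hn : StrictMono n) (hn0 : ∀ i, 0 < n i) (N : ℕ) : HTwo 16 (SQ n N) := by
  intro W' W f hf
  set V := W' ∪ W.biUnion (fun y => Icc (y - (n N : ℤ)) (y + n N)) with hVdef
  have hV : ∀ m ≤ n N, ∀ y ∈ W, ∀ x ∈ Icc (y - (m:ℤ)) (y + m), x ∈ V := by
    intro m hm y hy x hx
    rw [hVdef, mem_union, mem_biUnion]
    right; refine ⟨y, hy, ?_⟩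
    rw [mem_Icc] at *; omega
  have hle : ∑ x ∈ W', ‖SQ n N f x‖ ^ 2 ≤ ∑ x ∈ V, ‖SQ n N f x‖ ^ 2 :=
    sum_le_sum_of_subset_of_nonneg subset_union_left fun _ _ _ => sq_nonneg _
  refine hle.trans ?_
  have hpi : 0 < 2 * Real.pi := by positivity
  have key : 2 * Real.pi * ∑ x ∈ V, ‖SQ n N f x‖ ^ 2 ≤ 2 * Real.pi * (16 * ∑ x ∈ W, ‖f x‖ ^ 2) := by
    have e1 : ∑ x ∈ V, ‖SQ n N f x‖ ^ 2 
        = ∑ i ∈ range N, ∑ x ∈ V, ‖((zavg (n i) f x - zavg (n (i+1)) f x : ℝ) : ℂ)‖ ^ 2 := by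
      rw [sum_comm]
      refine sum_congr rfl fun x _ => ?_
      rw [SQ_norm_sq]
      refine sum_congr rfl fun i _ => ?_
      rw [Complex.norm_real, Real.norm_eq_abs, sq_abs]
    have e2 : ∀ i ∈ range N, ∀ θ, ∑ x ∈ V, ((zavg (n i) f x - zavg (n (i+1)) f x : ℝ) : ℂ) * circ θ ^ x
        = (∑ y ∈ W, (f y : ℂ) * circ θ ^ y) * (dker (circ θ) (n i) - dker (circ θ) (n (i+1))) := by
      intro i hi θ
      rw [mem_range] at hi
      rw [mul_sub, ← zavg_fourier _ f W V hf (hV _ (hn.monotone hi.le)) _ (circ_ne θ),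
        ← zavg_fourier _ f W V hf (hV _ (hn.monotone hi)) _ (circ_ne θ), ← sum_sub_distrib]
      refine sum_congr rfl fun x _ => ?_
      push_cast; ring
    have hcont : ∀ (U : Finset ℤ) (c : ℤ → ℂ), Continuous fun θ : ℝ => ‖∑ k ∈ U, c k * circ θ ^ k‖ ^ 2 :=
      fun U c => (continuous_finsetSum _ fun k _ => (circ_cont k).const_mul _).norm.pow 2
    have e4 : ∑ x ∈ W, ‖f x‖ ^ 2 = ∑ x ∈ W, ‖(f x : ℂ)‖ ^ 2 := by
      simp only [Complex.norm_real]
    rw [e1, mul_sum]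
    simp only [← parseval]
    rw [e4, ← mul_assoc, mul_comm (2 * Real.pi) 16, mul_assoc, ← parseval,
      ← intervalIntegral.integral_finsetSum (fun i _ => (hcont _ _).intervalIntegrable _ _),
      ← intervalIntegral.integral_const_mul]
    apply intervalIntegral.integral_mono_on hpi.le
    · exact (continuous_finsetSum _ fun i _ => hcont _ _).intervalIntegrable _ _
    · exact ((hcont _ _).const_mul _).intervalIntegrable _ _
    · intro θ _
      have : ∀ i ∈ range N, ‖∑ x ∈ V, ((zavg (n i) f x - zavg (n (i+1)) f x : ℝ) : ℂ) * circ θ ^ x‖ ^ 2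
         = ‖∑ y ∈ W, (f y : ℂ) * circ θ ^ y‖ ^ 2 * ‖dker (circ θ) (n i) - dker (circ θ) (n (i+1))‖ ^ 2 := by
        intro i hi
        rw [e2 i hi, norm_mul, mul_pow]
      rw [sum_congr rfl this, ← mul_sum, mul_comm]
      gcongr
      exact dker_square _ (circ_norm θ) n hn hn0 N
  exact le_of_mul_le_mul_left key hpi

lemma cs_bound (X Y : ℝ) (A : ℝ) (hX : 0 ≤ X) (h : X ^ 2 ≤ A * X * Y) (hAY : 0 ≤ A * Y) : X ≤ A * Y := by
  rcases hX.eq_or_lt with h0 | h0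
  · rw [← h0]; exact hAY
  · have : X * X ≤ X * (A * Y) := by nlinarith
    exact le_of_mul_le_mul_left this h0

lemma SA_two (n : ℕ → ℕ) (hn : StrictMono n) (hn0 : ∀ i, 0 < n i) (N : ℕ) : HTwo 16 (SA n N) := by
  intro W' W g hg
  set h : ℤ → ℝ := fun x => if x ∈ W' then SA n N g x else 0 with hh
  have h0 : ∀ x ∉ W', h x = 0 := fun x hx => by simp [hh, hx]
  have e1 : ∑ x ∈ W', ‖SA n N g x‖ ^ 2 = ∑ x ∈ W', h x * SA n N g x := by
    refine sum_congr rfl fun x hx => ?_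
    simp only [hh, if_pos hx]
    rw [Real.norm_eq_abs, sq_abs, sq]
  have e2 : ∑ x ∈ W', ‖h x‖ ^ 2 = ∑ x ∈ W', ‖SA n N g x‖ ^ 2 := by
    refine sum_congr rfl fun x hx => ?_
    simp only [hh, if_pos hx]
  have h2 := SQ_two n hn hn0 N W W' h h0
  rw [e2] at h2
  rw [SQ_SA n N W' W h g h0 hg] at e1
  have h3 : ∑ x ∈ W', ‖SA n N g x‖ ^ 2 ≤ ∑ y ∈ W, ‖g y‖ * ‖SQ n N h y‖ := by
    rw [e1]; exact sum_le_sum fun y _ => real_inner_le_norm _ _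
  have h4 := sum_mul_sq_le_sq_mul_sq W (fun y => ‖g y‖) (fun y => ‖SQ n N h y‖)
  have hX : 0 ≤ ∑ x ∈ W', ‖SA n N g x‖ ^ 2 := sum_nonneg fun _ _ => sq_nonneg _
  have hY : 0 ≤ ∑ x ∈ W, ‖g x‖ ^ 2 := sum_nonneg fun _ _ => sq_nonneg _
  refine cs_bound _ _ _ hX ?_ (by positivity)
  have h5 : (∑ x ∈ W', ‖SA n N g x‖ ^ 2) ^ 2 ≤ (∑ y ∈ W, ‖g y‖ * ‖SQ n N h y‖) ^ 2 := by gcongr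
  nlinarith


lemma inj_sum (S : Finset ℤ) (g : ℤ → ℕ) (hg : Set.InjOn g S) (s : ℕ) (hs : s ≠ 0)
    (h : ∀ x ∈ S, s < g x) : ∑ x ∈ S, ((g x : ℝ) ^ 2)⁻¹ ≤ (s:ℝ)⁻¹ := by
  have e : ∑ x ∈ S, ((g x : ℝ) ^ 2)⁻¹ = ∑ i ∈ S.image g, ((i : ℝ) ^ 2)⁻¹ := by
    rw [sum_image hg]
  rw [e]
  have hsub : S.image g ⊆ Ioc s (s + S.sup g) := by
    intro i hi
    obtain ⟨x, hx, rfl⟩ := mem_image.1 hi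
    rw [mem_Ioc]
    have : g x ≤ S.sup g := le_sup hx
    exact ⟨h x hx, by omega⟩
  refine (sum_le_sum_of_subset_of_nonneg hsub fun _ _ _ => by positivity).trans ?_
  refine (sum_Ioc_inv_sq_le_sub hs (by omega)).trans ?_
  have : 0 ≤ (((s + S.sup g : ℕ) : ℝ))⁻¹ := by positivity
  linarith

/-- distance to an interval -/
def idist (q : ℤ × ℤ) (x : ℤ) : ℕ := if x < q.1 then (q.1 - x).natAbs else (x - q.2).natAbs

lemma far_sum (q : ℤ × ℤ) (hq : q.1 ≤ q.2) (W : Finset ℤ) (hW : ∀ x ∈ W, x ∉ starI q) :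
    ∑ x ∈ W, ((idist q x : ℝ) ^ 2)⁻¹ ≤ 2 * ((q.2:ℝ) - q.1 + 1)⁻¹ := by
  have hs : (((q.2 - q.1 + 1).toNat : ℕ) : ℝ) = (q.2:ℝ) - q.1 + 1 := by
    have : (((q.2 - q.1 + 1).toNat : ℕ) : ℤ) = q.2 - q.1 + 1 := by omega
    have h2 : ((((q.2 - q.1 + 1).toNat : ℕ) : ℤ) : ℝ) = ((q.2 - q.1 + 1 : ℤ) : ℝ) := by rw [this]
    push_cast at h2; simpa using h2
  rw [← sum_filter_add_sum_filter_not W (fun x => x < q.1), ← hs]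
  have key : ∀ x ∈ W, x < q.1 - (q.2 - q.1 + 1) ∨ q.2 + (q.2 - q.1 + 1) < x := by
    intro x hx
    have := hW x hx
    rw [starI, mem_Icc] at this
    omega
  have h1 := inj_sum (W.filter (fun x => x < q.1)) (idist q) (by
    intro x hx y hy hxy
    have hx' := (mem_filter.1 hx).2
    have hy' := (mem_filter.1 hy).2
    simp only [idist, if_pos hx', if_pos hy'] at hxy
    omega) (q.2 - q.1 + 1).toNat (by omega) (by
    intro x hx
    have hx' := mem_filter.1 hx
    have := key x hx'.1
    simp only [idist, if_pos hx'.2]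
    omega)
  have h2 := inj_sum (W.filter (fun x => ¬ x < q.1)) (idist q) (by
    intro x hx y hy hxy
    have hx' := (mem_filter.1 hx)
    have hy' := (mem_filter.1 hy)
    have := key x hx'.1
    have := key y hy'.1
    simp only [idist, if_neg hx'.2, if_neg hy'.2] at hxy
    omega) (q.2 - q.1 + 1).toNat (by omega) (by
    intro x hx
    have hx' := mem_filter.1 hx
    have := key x hx'.1
    simp only [idist, if_neg hx'.2]
    omega)
  linarith

lemma IFam.card_le {Q : Finset (ℤ × ℤ)} (hQ : IFam Q) (y : ℤ) :
    (Q.filter (fun q => y ∈ Icc q.1 q.2)).card ≤ 1 := by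
  rw [card_le_one]
  intro q hq q' hq'
  rw [mem_filter] at hq hq'
  by_contra hne
  exact (disjoint_left.1 (hQ.2 q hq.1 q' hq'.1 hne)) hq.2 hq'.2

lemma SQ_off (n : ℕ → ℕ) (hn : StrictMono n) (N : ℕ) : HOff 8 (SQ n N) := by
  classical
  intro l hl Q hQ b hb0 hbc hbl W' hW'
  set Ω := Q.biUnion (fun q => Icc q.1 q.2) with hΩ
  have hΩm : ∀ x, x ∈ Ω ↔ ∃ q ∈ Q, x ∈ Icc q.1 q.2 := fun x => by rw [hΩ, mem_biUnion]
  have hbΩ : ∀ x ∉ Ω, b x = 0 := fun x hx => hb0 x fun q hq hxq => hx ((hΩm x).2 ⟨q, hq, hxq⟩)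
  have hpt : ∀ x ∈ W', ‖SQ n N b x‖ ^ 2 ≤
      4 * ∑ q ∈ Q, (l * ((q.2:ℝ) - q.1 + 1)) ^ 2 * ((idist q x : ℝ) ^ 2)⁻¹ := by
    intro x hx
    set c : ℤ × ℤ → ℕ → ℝ := fun q m => ∑ k ∈ Icc q.1 q.2, b k * vker m (k - x).natAbs with hc
    have hz : ∀ m, zavg m b x = ∑ q ∈ Q, c q m := fun m => by
      rw [zavg_eq m b Ω hbΩ x, hQ.sum_eq Ω hΩm]
    have hfar : ∀ q ∈ Q, x < q.1 - (q.2 - q.1 + 1) ∨ q.2 + (q.2 - q.1 + 1) < x := by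
      intro q hq
      have := hW' x hx q hq
      rw [starI, mem_Icc] at this
      omega
    have hr : ∀ m, (Q.filter (fun q => c q m ≠ 0)).card ≤ 2 := by
      intro m
      have hsub : Q.filter (fun q => c q m ≠ 0) ⊆
          Q.filter (fun q => x + m ∈ Icc q.1 q.2) ∪ Q.filter (fun q => x - m ∈ Icc q.1 q.2) := by
        intro q hq
        rw [mem_filter] at hq
        rw [mem_union, mem_filter, mem_filter]
        by_contra hcon
        apply hq.2
        have hle := hQ.1 q hq.1
        have hf := hfar q hq.1
        simp only [mem_Icc, hq.1, true_and, not_or] at hcon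
        have hconst : ∀ k ∈ Icc q.1 q.2, b k * vker m (k - x).natAbs = b k * vker m (q.1 - x).natAbs := by
          intro k hk
          rw [mem_Icc] at hk
          have : ((k - x).natAbs ≤ m) ↔ ((q.1 - x).natAbs ≤ m) := by
            omega
          by_cases h : (q.1 - x).natAbs ≤ m
          · rw [vker, vker, if_pos h, if_pos (this.2 h)]
          · rw [vker, vker, if_neg h, if_neg (fun h' => h (this.1 h'))]
        simp only [hc]
        rw [sum_congr rfl hconst, ← sum_mul, hbc q hq.1, zero_mul]
      refine (card_le_card hsub).trans ((card_union_le _ _).trans ?_)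
      have := hQ.card_le (x + m)
      have := hQ.card_le (x - m)
      omega
    rw [SQ_norm_sq]
    simp only [hz]
    refine (pieces Q c 2 n N hr).trans ?_
    have h22 : ((2 * 2 : ℕ) : ℝ) = 4 := by norm_num
    rw [h22]
    gcongr with q hq
    have hle := hQ.1 q hq
    have hf := hfar q hq
    have hepos : 0 < idist q x := by unfold idist; split_ifs <;> omega
    have hep : (0:ℝ) < idist q x := by exact_mod_cast hepos
    have hv : ∑ i ∈ range N, |c q (n i) - c q (n (i+1))| ≤ l * ((q.2:ℝ) - q.1 + 1) * (idist q x : ℝ)⁻¹ := by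
      refine (var_sum n hn N (Icc q.1 q.2) b (fun k => (k - x).natAbs)).trans ?_
      calc _ ≤ ∑ k ∈ Icc q.1 q.2, ‖b k‖ * (idist q x : ℝ)⁻¹ := by
            refine sum_le_sum fun k hk => ?_
            rw [mem_Icc] at hk
            rw [Real.norm_eq_abs]
            have : idist q x ≤ (k - x).natAbs := by unfold idist; split_ifs <;> omega
            have h2 : (idist q x : ℝ) ≤ ((k - x).natAbs : ℝ) := by exact_mod_cast this
            gcongr
            rw [div_le_iff₀ (by positivity), inv_mul_eq_div, le_div_iff₀ hep]
            linarith
        _ ≤ _ := by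
            rw [← sum_mul]
            gcongr
            exact hbl q hq
    have h0 : 0 ≤ ∑ i ∈ range N, |c q (n i) - c q (n (i+1))| := sum_nonneg fun _ _ => abs_nonneg _
    calc _ ≤ (l * ((q.2:ℝ) - q.1 + 1) * (idist q x : ℝ)⁻¹) ^ 2 := by gcongr
      _ = _ := by rw [mul_pow, inv_pow]
  calc _ ≤ ∑ x ∈ W', 4 * ∑ q ∈ Q, (l * ((q.2:ℝ) - q.1 + 1)) ^ 2 * ((idist q x : ℝ) ^ 2)⁻¹ :=
        sum_le_sum hpt
    _ = 4 * ∑ q ∈ Q, (l * ((q.2:ℝ) - q.1 + 1)) ^ 2 * ∑ x ∈ W', ((idist q x : ℝ) ^ 2)⁻¹ := by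
        rw [← mul_sum, sum_comm]; simp only [mul_sum]
    _ ≤ 4 * ∑ q ∈ Q, 2 * l ^ 2 * ((q.2:ℝ) - q.1 + 1) := by
        refine mul_le_mul_of_nonneg_left (sum_le_sum fun q hq => ?_) (by norm_num)
        have hle : (q.1:ℝ) ≤ q.2 := by exact_mod_cast hQ.1 q hq
        have := far_sum q (hQ.1 q hq) W' (fun x hx => hW' x hx q hq)
        have hs : 0 < (q.2:ℝ) - q.1 + 1 := by linarith
        calc _ ≤ (l * ((q.2:ℝ) - q.1 + 1)) ^ 2 * (2 * ((q.2:ℝ) - q.1 + 1)⁻¹) := by gcongr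
          _ = _ := by field_simp
    _ = _ := by rw [← mul_sum]; ring


lemma abel_le (w a : ℕ → ℝ) (B : ℝ) (hw : Antitone w) (hw0 : ∀ i, 0 ≤ w i)
    (h : ∀ m, ∑ i ∈ range m, a i ≤ m * B) (M : ℕ) :
    ∑ i ∈ range M, w i * a i ≤ B * ∑ i ∈ range M, w i := by
  cases M with
  | zero => simp
  | succ M =>
    have key : ∀ M : ℕ, w M * ((M+1) * B - ∑ i ∈ range (M+1), a i)
        ≤ B * ∑ i ∈ range (M+1), w i - ∑ i ∈ range (M+1), w i * a i := by
      intro M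
      induction M with
      | zero => simp; apply le_of_eq; ring
      | succ M ih =>
        rw [sum_range_succ a, sum_range_succ w, sum_range_succ (fun i => w i * a i)]
        have h1 : 0 ≤ (M+1) * B - ∑ i ∈ range (M+1), a i := by
          have := h (M+1); push_cast at this; linarith
        have h2 : w (M+1) * ((M+1) * B - ∑ i ∈ range (M+1), a i) ≤ w M * ((M+1) * B - ∑ i ∈ range (M+1), a i) :=
          mul_le_mul_of_nonneg_right (hw (Nat.le_succ M)) h1
        push_cast
        nlinarith
    have h1 : 0 ≤ (M+1) * B - ∑ i ∈ range (M+1), a i := by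
      have := h (M+1); push_cast at this; linarith
    have := key M
    have := mul_nonneg (hw0 M) h1
    linarith

/-- weights -/
noncomputable def wgt (i : ℕ) : ℝ := ((i:ℝ) + 1) ^ (-(3/2):ℝ)

lemma wgt_nonneg (i : ℕ) : 0 ≤ wgt i := by unfold wgt; positivity

lemma wgt_anti : Antitone wgt := by
  intro i j hij
  unfold wgt
  have : (i:ℝ) ≤ j := by exact_mod_cast hij
  exact Real.rpow_le_rpow_of_nonpos (by positivity) (by linarith) (by norm_num)

lemma wgt_sum : ∃ Z : ℝ, 0 < Z ∧ ∀ M, ∑ i ∈ range M, wgt i ≤ Z := by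
  have hs : Summable wgt := by
    have h := (summable_nat_add_iff 1).2 (Real.summable_nat_rpow (p := -(3/2)) |>.2 (by norm_num))
    refine h.congr fun i => ?_
    unfold wgt; push_cast; rfl
  refine ⟨1 + ∑' i, wgt i, ?_, fun M => ?_⟩
  · have : 0 ≤ ∑' i, wgt i := tsum_nonneg wgt_nonneg
    linarith
  · have := hs.sum_le_tsum (range M) (fun i _ => wgt_nonneg i)
    linarith

/-- block index -/
def blk (a s k : ℤ) : ℤ := (k - a) / s

lemma blk_lo (a s k : ℤ) (hs : 0 < s) : blk a s k * s ≤ k - a := Int.ediv_mul_le _ hs.ne'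
lemma blk_hi (a s k : ℤ) (hs : 0 < s) : k - a < (blk a s k + 1) * s := Int.lt_ediv_add_one_mul_self _ hs

lemma blk_close (a s k k' : ℤ) (hs : 0 < s) (h1 : k - k' < s) : blk a s k ≤ blk a s k' + 1 := by
  have := blk_lo a s k hs
  have := blk_hi a s k' hs
  by_contra hcon
  push Not at hcon
  have : (blk a s k' + 2) * s ≤ blk a s k * s := by
    apply mul_le_mul_of_nonneg_right _ hs.le; omega
  nlinarith

lemma wgt_block (φ : ℤ → ℝ) (hφ : ∀ x, 0 ≤ φ x) (W : Finset ℤ) (hW : ∀ x ∉ W, φ x = 0)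
    (Z : ℝ) (hZ : ∀ M, ∑ i ∈ range M, wgt i ≤ Z) (a s w : ℤ) (hs : 0 < s) (hw : w ∈ Icc a (a + s - 1)) :
    ∑ k ∈ W, wgt (blk a s k).natAbs * φ k ≤ 2 * s * HLM φ w * Z := by
  rw [mem_Icc] at hw
  have hsr : (0:ℝ) < s := by exact_mod_cast hs
  have hH := HLM_nonneg φ hφ w
  set g : ℤ → ℕ := fun k => (blk a s k).natAbs with hg
  set M := W.sup g + 1 with hM
  have hmap : ∀ k ∈ W, g k ∈ range M := fun k hk => by
    have : g k ≤ W.sup g := le_sup hk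
    rw [mem_range]; omega
  set A : ℕ → ℝ := fun i => ∑ k ∈ W with g k = i, φ k with hA
  have e : ∑ k ∈ W, wgt (g k) * φ k = ∑ i ∈ range M, wgt i * A i := by
    rw [← sum_fiberwise_of_maps_to hmap]
    refine sum_congr rfl fun i _ => ?_
    rw [hA, mul_sum]
    refine sum_congr rfl fun k hk => ?_
    rw [(mem_filter.1 hk).2]
  have hpart : ∀ m : ℕ, ∑ i ∈ range m, A i ≤ m * (2 * s * HLM φ w) := by
    intro m
    rcases Nat.eq_zero_or_pos m with rfl | hm
    · simp
    have e2 : ∑ i ∈ range m, A i = ∑ k ∈ W with g k < m, φ k := by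
      rw [← sum_fiberwise_of_maps_to (s := W.filter (fun k => g k < m)) (t := range m) (g := g)
        (fun k hk => mem_range.2 (mem_filter.1 hk).2)]
      refine sum_congr rfl fun i hi => ?_
      rw [hA, filter_filter]
      refine sum_congr ?_ fun _ _ => rfl
      ext k
      rw [mem_range] at hi
      simp only [mem_filter]
      constructor
      · rintro ⟨h1, h2⟩; exact ⟨h1, by omega, h2⟩
      · rintro ⟨h1, _, h2⟩; exact ⟨h1, h2⟩
    rw [e2]
    have hms : (0:ℤ) ≤ (m - 1) * s := mul_nonneg (by omega) hs.le
    have hsub : W.filter (fun k => g k < m) ⊆ Icc (a - (m-1) * s) (a + m * s - 1) := by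
      intro k hk
      have hk2 := (mem_filter.1 hk).2
      simp only [hg] at hk2
      have h1 := blk_lo a s k hs
      have h2 := blk_hi a s k hs
      have h3 : -((m:ℤ)-1) * s ≤ blk a s k * s := mul_le_mul_of_nonneg_right (by omega) hs.le
      have h4 : (blk a s k + 1) * s ≤ m * s := mul_le_mul_of_nonneg_right (by omega) hs.le
      rw [mem_Icc]
      constructor <;> linarith
    refine (sum_le_sum_of_subset_of_nonneg hsub fun _ _ _ => hφ _).trans ?_
    refine (HLM_ge φ hφ W hW w _ _ (by linarith) (by nlinarith)).trans ?_
    have hmr : (1:ℝ) ≤ m := by exact_mod_cast hm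
    have : (((a + m * s - 1 : ℤ)) : ℝ) - ((a - (m-1) * s : ℤ) : ℝ) + 1 ≤ m * (2 * s) := by
      push_cast; nlinarith
    calc _ ≤ (m * (2 * s)) * HLM φ w := by gcongr
      _ = _ := by ring
  rw [e]
  refine (abel_le wgt A _ wgt_anti wgt_nonneg hpart M).trans ?_
  have : 0 ≤ 2 * s * HLM φ w := by positivity
  exact mul_le_mul_of_nonneg_left (hZ M) this

lemma jensen32 (S : Finset ℤ) (s : ℝ) (hs : 0 < s) (hS : (S.card : ℝ) ≤ s) (u : ℤ → ℝ) (hu : ∀ x, 0 ≤ u x)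
    (t : ℝ) (ht : 0 ≤ t) :
    (6 / ((t + 1) * s) * ∑ k ∈ S, u k) ^ (3/2:ℝ)
      ≤ 6 ^ (3/2:ℝ) * s⁻¹ * ((t+1) ^ (-(3/2):ℝ) * ∑ k ∈ S, u k ^ (3/2:ℝ)) := by
  have h0 : 0 ≤ ∑ k ∈ S, u k := sum_nonneg fun _ _ => hu _
  have hJ : (∑ k ∈ S, u k) ^ (3/2:ℝ) ≤ (S.card:ℝ) ^ ((3/2:ℝ) - 1) * ∑ k ∈ S, u k ^ (3/2:ℝ) := by
    exact Real.rpow_sum_le_const_mul_sum_rpow_of_nonneg S (by norm_num) (fun i _ => hu i)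
  have hG : 0 ≤ ∑ k ∈ S, u k ^ (3/2:ℝ) := sum_nonneg fun _ _ => Real.rpow_nonneg (hu _) _
  have hS' : (S.card:ℝ) ^ ((3/2:ℝ) - 1) ≤ s ^ ((3/2:ℝ) - 1) :=
    Real.rpow_le_rpow (by positivity) hS (by norm_num)
  rw [Real.mul_rpow (by positivity) h0, Real.div_rpow (by norm_num) (by positivity),
    Real.mul_rpow (by positivity) hs.le]
  have e1 : (t+1) ^ (-(3/2):ℝ) = ((t+1) ^ (3/2:ℝ))⁻¹ := Real.rpow_neg (by positivity) _
  have e2 : s⁻¹ = (s ^ (3/2:ℝ))⁻¹ * s ^ ((3/2:ℝ) - 1) := by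
    rw [← Real.rpow_neg hs.le, ← Real.rpow_add hs, ← Real.rpow_neg_one]; norm_num
  rw [e1, e2]
  calc _ ≤ 6 ^ (3/2:ℝ) / ((t+1) ^ (3/2:ℝ) * s ^ (3/2:ℝ)) *
        (s ^ ((3/2:ℝ) - 1) * ∑ k ∈ S, u k ^ (3/2:ℝ)) := by
        gcongr
        exact hJ.trans (by gcongr)
    _ = _ := by
        rw [div_eq_mul_inv, mul_inv]; ring

lemma sum_sq_le_rpow {J : Type*} (J0 : Finset J) (V : J → ℝ) (hV : ∀ j, 0 ≤ V j) :
    ∑ j ∈ J0, V j ^ 2 ≤ (∑ j ∈ J0, V j ^ (3/2:ℝ)) ^ (4/3:ℝ) := by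
  have h : ∀ j, V j ^ 2 = (V j ^ (3/2:ℝ)) ^ (4/3:ℝ) := fun j => by
    rw [← Real.rpow_mul (hV j)]; norm_num
  simp only [h]
  set a : J → ℝ := fun j => V j ^ (3/2:ℝ)
  have ha : ∀ j, 0 ≤ a j := fun j => Real.rpow_nonneg (hV j) _
  have hS : 0 ≤ ∑ j ∈ J0, a j := sum_nonneg fun j _ => ha j
  have e : ∀ x : ℝ, 0 ≤ x → x ^ (4/3:ℝ) = x * x ^ (1/3:ℝ) := fun x hx => by
    rw [show (4/3:ℝ) = 1 + 1/3 by norm_num, Real.rpow_add_of_nonneg hx (by norm_num) (by norm_num),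
      Real.rpow_one]
  change ∑ j ∈ J0, a j ^ (4/3:ℝ) ≤ (∑ j ∈ J0, a j) ^ (4/3:ℝ)
  rw [e _ hS, sum_mul]
  refine sum_le_sum fun j hj => ?_
  rw [e _ (ha j)]
  have : a j ≤ ∑ j ∈ J0, a j := single_le_sum (fun j _ => ha j) hj
  have h0 := ha j
  gcongr


lemma blk_card (W : Finset ℤ) (a s j : ℤ) (hs : 0 < s) :
    ((W.filter (fun k => blk a s k = j)).card : ℝ) ≤ s := by
  have hsub : W.filter (fun k => blk a s k = j) ⊆ Icc (a + j * s) (a + j * s + s - 1) := by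
    intro k hk
    have hk2 := (mem_filter.1 hk).2
    have h1 := blk_lo a s k hs
    have h2 := blk_hi a s k hs
    rw [hk2] at h1 h2
    rw [mem_Icc]; constructor <;> linarith
  have := card_le_card hsub
  have h3 : ((Icc (a + j * s) (a + j * s + s - 1)).card : ℝ) = s := by
    rw [icc_card_real _ _ (by omega)]; push_cast; ring
  rw [← h3]; exact_mod_cast this

lemma blk_dist (a s k y : ℤ) (hs : 0 < s) (hy1 : a ≤ y) (hy2 : y ≤ a + s - 1)
    (hk : k < a - s ∨ a + s - 1 + s < k) :
    (((blk a s k).natAbs : ℤ) + 1) * s ≤ 3 * (k - y).natAbs := by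
  have h1 := blk_lo a s k hs
  have h2 := blk_hi a s k hs
  set j := blk a s k
  rcases hk with hk | hk
  · have hj : j ≤ -2 := by
      by_contra hcon
      have : (-1) * s ≤ j * s := mul_le_mul_of_nonneg_right (by omega) hs.le
      linarith
    have e1 : (j.natAbs : ℤ) = -j := by omega
    have e2 : (((k - y).natAbs : ℕ) : ℤ) = y - k := by omega
    rw [e1, e2]
    nlinarith
  · have hj : 2 ≤ j := by
      by_contra hcon
      have : (j+1) * s ≤ 2 * s := mul_le_mul_of_nonneg_right (by omega) hs.le
      linarith
    have e1 : (j.natAbs : ℤ) = j := by omega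
    have e2 : (((k - y).natAbs : ℕ) : ℤ) = k - y := by omega
    rw [e1, e2]
    nlinarith

lemma osc (Z : ℝ) (hZ : ∀ M, ∑ i ∈ range M, wgt i ≤ Z)
    (n : ℕ → ℕ) (hn : StrictMono n) (N : ℕ) (q : ℤ × ℤ) (hq : q.1 ≤ q.2) (W : Finset ℤ) (h : ℤ → ℝ)
    (hW : ∀ x ∉ W, h x = 0) (hst : ∀ x ∈ starI q, h x = 0) (y z w : ℤ)
    (hy : y ∈ Icc q.1 q.2) (hz : z ∈ Icc q.1 q.2) (hw : w ∈ Icc q.1 q.2) :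
    ‖SQ n N h y - SQ n N h z‖ ^ 2 ≤
      12 * (2 * 6 ^ (3/2:ℝ) * Z * HLM (fun k => |h k| ^ (3/2:ℝ)) w) ^ (4/3:ℝ) := by
  classical
  set a := q.1 with ha
  set s := q.2 - q.1 + 1 with hsdef
  have hs : 0 < s := by omega
  have hsr : (0:ℝ) < s := by exact_mod_cast hs
  have hq2 : q.2 = a + s - 1 := by omega
  rw [hq2] at hy hz hw
  have hfar : ∀ k, h k ≠ 0 → k < a - s ∨ a + s - 1 + s < k := by
    intro k hk
    have : k ∉ starI q := fun hk' => hk (hst k hk')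
    rw [starI, mem_Icc] at this
    omega
  set φ : ℤ → ℝ := fun k => |h k| ^ (3/2:ℝ) with hφdef
  have hφ : ∀ x, 0 ≤ φ x := fun x => Real.rpow_nonneg (abs_nonneg _) _
  have hφW : ∀ x ∉ W, φ x = 0 := fun x hx => by
    simp only [hφdef, hW x hx, abs_zero]; exact Real.zero_rpow (by norm_num)
  set J0 := W.image (blk a s) with hJ0
  set c : ℤ → ℕ → ℝ := fun j m => ∑ k ∈ W with blk a s k = j, h k * vker m (k - y).natAbs
    - ∑ k ∈ W with blk a s k = j, h k * vker m (k - z).natAbs with hc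
  have hcs : ∀ m, zavg m h y - zavg m h z = ∑ j ∈ J0, c j m := by
    intro m
    have hmap : ∀ k ∈ W, blk a s k ∈ J0 := fun k hk => mem_image_of_mem _ hk
    rw [zavg_eq m h W hW, zavg_eq m h W hW, sum_sub_distrib, sum_fiberwise_of_maps_to hmap,
      sum_fiberwise_of_maps_to hmap]
  rw [mem_Icc] at hy hz
  have hr : ∀ m, (J0.filter (fun j => c j m ≠ 0)).card ≤ 6 := by
    intro m
    set t := blk a s (y + m)
    set t' := blk a s (y - m)
    have hsub : J0.filter (fun j => c j m ≠ 0) ⊆ {t-1, t, t+1, t'-1, t', t'+1} := by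
      intro j hj
      have hcj := (mem_filter.1 hj).2
      have e : c j m = ∑ k ∈ W with blk a s k = j, (h k * vker m (k - y).natAbs - h k * vker m (k - z).natAbs) := by
        rw [hc, sum_sub_distrib]
      rw [e] at hcj
      obtain ⟨k, hk, hne⟩ := exists_ne_zero_of_sum_ne_zero hcj
      have hkj := (mem_filter.1 hk).2
      have hhk : h k ≠ 0 := by
        intro h0; apply hne; rw [h0]; ring
      have hf := hfar k hhk
      have hdiff : ¬ (((k - y).natAbs ≤ m) ↔ ((k - z).natAbs ≤ m)) := by
        intro hiff
        apply hne
        by_cases h1 : (k - z).natAbs ≤ m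
        · rw [vker, vker, if_pos h1, if_pos (hiff.2 h1), sub_self]
        · rw [vker, vker, if_neg h1, if_neg (fun h' => h1 (hiff.1 h')), sub_self]
      simp only [mem_insert, mem_singleton]
      rcases hf with hf | hf
      · have h1 := blk_close a s k (y - m) hs (by omega)
        have h2 := blk_close a s (y - m) k hs (by omega)
        rw [hkj] at h1 h2
        omega
      · have h1 := blk_close a s k (y + m) hs (by omega)
        have h2 := blk_close a s (y + m) k hs (by omega)
        rw [hkj] at h1 h2
        omega
    exact (card_le_card hsub).trans card_le_six
  have e0 : ‖SQ n N h y - SQ n N h z‖ ^ 2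
      = ∑ i ∈ range N, (∑ j ∈ J0, c j (n i) - ∑ j ∈ J0, c j (n (i+1))) ^ 2 := by
    rw [EuclideanSpace.real_norm_sq_eq, ← Fin.sum_univ_eq_sum_range
      (fun i => (∑ j ∈ J0, c j (n i) - ∑ j ∈ J0, c j (n (i+1))) ^ 2)]
    refine sum_congr rfl fun i _ => ?_
    rw [← hcs, ← hcs]
    simp [SQ]; ring
  rw [e0]
  refine (pieces J0 c 6 n N hr).trans ?_
  have h12 : ((2 * 6 : ℕ) : ℝ) = 12 := by norm_num
  rw [h12]
  refine mul_le_mul_of_nonneg_left ?_ (by norm_num)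
  set V : ℤ → ℝ := fun j => ∑ i ∈ range N, |c j (n i) - c j (n (i+1))| with hVdef
  have hV0 : ∀ j, 0 ≤ V j := fun j => sum_nonneg fun _ _ => abs_nonneg _
  refine (sum_sq_le_rpow J0 V hV0).trans ?_
  refine Real.rpow_le_rpow (sum_nonneg fun j _ => Real.rpow_nonneg (hV0 j) _) ?_ (by norm_num)
  have hV : ∀ j, V j ≤ 6 / (((j.natAbs:ℝ) + 1) * s) * ∑ k ∈ W with blk a s k = j, |h k| := by
    intro j
    have h1 := var_sum n hn N (W.filter (fun k => blk a s k = j)) h (fun k => (k - y).natAbs)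
    have h2 := var_sum n hn N (W.filter (fun k => blk a s k = j)) h (fun k => (k - z).natAbs)
    have h3 : ∀ y', a ≤ y' → y' ≤ a + s - 1 → ∑ k ∈ W with blk a s k = j, |h k| * (2 / (2 * ((k - y').natAbs:ℝ) + 1))
        ≤ 3 / (((j.natAbs:ℝ) + 1) * s) * ∑ k ∈ W with blk a s k = j, |h k| := by
      intro y' h1 h2
      rw [mul_sum]
      refine sum_le_sum fun k hk => ?_
      by_cases h0 : h k = 0
      · simp [h0]
      · have hkj := (mem_filter.1 hk).2
        have hd := blk_dist a s k y' hs h1 h2 (hfar k h0)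
        rw [hkj] at hd
        have hd' : ((j.natAbs:ℝ) + 1) * s ≤ 3 * ((k - y').natAbs : ℝ) := by
          generalize j.natAbs = p1 at hd ⊢
          generalize (k - y').natAbs = p2 at hd ⊢
          have h5 := (Int.cast_le (R := ℝ)).2 hd
          push_cast at h5
          exact h5
        rw [mul_comm]
        have hpos : 0 < ((j.natAbs:ℝ) + 1) * s := by positivity
        gcongr ?_ * _
        rw [div_le_div_iff₀ (by positivity) hpos]
        linarith
    have h3y := h3 y hy.1 hy.2
    have h3z := h3 z hz.1 hz.2
    calc V j ≤ ∑ i ∈ range N, (|∑ k ∈ W with blk a s k = j, h k * vker (n i) (k - y).natAbs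
          - ∑ k ∈ W with blk a s k = j, h k * vker (n (i+1)) (k - y).natAbs|
          + |∑ k ∈ W with blk a s k = j, h k * vker (n i) (k - z).natAbs
          - ∑ k ∈ W with blk a s k = j, h k * vker (n (i+1)) (k - z).natAbs|) := by
          refine sum_le_sum fun i _ => ?_
          refine le_trans (le_of_eq ?_) (abs_sub _ _)
          simp only [hc]; congr 1; ring
      _ ≤ _ := by
          rw [sum_add_distrib]
          have : 6 / (((j.natAbs:ℝ) + 1) * s) = 3 / (((j.natAbs:ℝ) + 1) * s) + 3 / (((j.natAbs:ℝ) + 1) * s) := by ring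
          rw [this, add_mul]
          linarith
  calc ∑ j ∈ J0, V j ^ (3/2:ℝ) 
      ≤ ∑ j ∈ J0, 6 ^ (3/2:ℝ) * (s:ℝ)⁻¹ * (wgt j.natAbs * ∑ k ∈ W with blk a s k = j, φ k) := by
        refine sum_le_sum fun j _ => ?_
        refine (Real.rpow_le_rpow (hV0 j) (hV j) (by norm_num)).trans ?_
        exact jensen32 _ s hsr (blk_card W a s j hs) (fun k => |h k|) (fun _ => abs_nonneg _) _ (by positivity)
    _ = 6 ^ (3/2:ℝ) * (s:ℝ)⁻¹ * ∑ k ∈ W, wgt (blk a s k).natAbs * φ k := by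
        rw [← mul_sum, ← sum_fiberwise_of_maps_to (s := W) (t := J0) (g := blk a s)
          (fun k hk => mem_image_of_mem _ hk)]
        congr 1
        refine sum_congr rfl fun j _ => ?_
        rw [mul_sum]
        refine sum_congr rfl fun k hk => ?_
        rw [(mem_filter.1 hk).2]
    _ ≤ 6 ^ (3/2:ℝ) * (s:ℝ)⁻¹ * (2 * s * HLM φ w * Z) := by
        gcongr
        exact wgt_block φ hφ W hφW Z hZ a s w hs hw
    _ = _ := by field_simp

lemma SA_off : ∃ A : ℝ, 0 ≤ A ∧ ∀ (n : ℕ → ℕ), StrictMono n → ∀ N, HOff A (SA n N) := by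
  classical
  obtain ⟨Z, hZ0, hZ⟩ := wgt_sum
  obtain ⟨C, hC, H⟩ := HLM_strong (4/3) (by norm_num) (by norm_num)
  set B : ℝ := 2 * 6 ^ (3/2:ℝ) * Z with hB
  have hB0 : 0 < B := by positivity
  set K2 : ℝ := 12 * B ^ (4/3:ℝ) with hK2
  have hK20 : 0 ≤ K2 := by positivity
  refine ⟨K2 * C, by positivity, ?_⟩
  intro n hn N l hl Q hQ b hb0 hbc hbl W' hW'
  set Ω := Q.biUnion (fun q => Icc q.1 q.2) with hΩ
  have hΩm : ∀ x, x ∈ Ω ↔ ∃ q ∈ Q, x ∈ Icc q.1 q.2 := fun x => by rw [hΩ, mem_biUnion]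
  have hbΩ : ∀ x ∉ Ω, b x = 0 := fun x hx => hb0 x fun q hq hxq => hx ((hΩm x).2 ⟨q, hq, hxq⟩)
  set h : ℤ → ℝ := fun x => if x ∈ W' then SA n N b x else 0 with hh
  have h0 : ∀ x ∉ W', h x = 0 := fun x hx => by simp [hh, hx]
  have hst : ∀ q ∈ Q, ∀ x ∈ starI q, h x = 0 := fun q hq x hx =>
    h0 x fun hxW => hW' x hxW q hq hx
  set φ : ℤ → ℝ := fun k => |h k| ^ (3/2:ℝ) with hφdef
  have hφ : ∀ x, 0 ≤ φ x := fun x => Real.rpow_nonneg (abs_nonneg _) _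
  have hφW : ∀ x ∉ W', φ x = 0 := fun x hx => by
    simp only [hφdef, h0 x hx, abs_zero]; exact Real.zero_rpow (by norm_num)
  have hHn := HLM_nonneg φ hφ
  set u : ℤ → ℝ := fun w => HLM φ w ^ (2/3:ℝ) with hu
  have hu0 : ∀ w, 0 ≤ u w := fun w => Real.rpow_nonneg (hHn w) _
  have hu2 : ∀ w, u w ^ 2 = HLM φ w ^ (4/3:ℝ) := fun w => by
    rw [hu, ← Real.rpow_natCast, ← Real.rpow_mul (hHn w)]; norm_num
  have hosc : ∀ q ∈ Q, ∀ y ∈ Icc q.1 q.2, ∀ w ∈ Icc q.1 q.2,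
      ‖SQ n N h y - SQ n N h q.1‖ ≤ Real.sqrt K2 * u w := by
    intro q hq y hy w hw
    have hle := hQ.1 q hq
    have h1 := osc Z hZ n hn N q hle W' h h0 (hst q hq) y q.1 w hy (by rw [mem_Icc]; omega) hw
    apply le_of_sq_le_sq _ (mul_nonneg (Real.sqrt_nonneg _) (hu0 w))
    rw [mul_pow, Real.sq_sqrt hK20, hu2]
    refine h1.trans (le_of_eq ?_)
    rw [Real.mul_rpow hB0.le (hHn w)]; ring
  set X := ∑ x ∈ W', ‖SA n N b x‖ ^ 2 with hX
  have hX0 : 0 ≤ X := sum_nonneg fun _ _ => sq_nonneg _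
  have e1 : X = ∑ q ∈ Q, ∑ y ∈ Icc q.1 q.2, inner ℝ (b y) (SQ n N h y) := by
    rw [← hQ.sum_eq Ω hΩm, ← SQ_SA n N W' Ω h b h0 hbΩ]
    refine sum_congr rfl fun x hx => ?_
    simp only [hh, if_pos hx]
    rw [Real.norm_eq_abs, sq_abs, sq]
  have e2 : ∀ q ∈ Q, ∑ y ∈ Icc q.1 q.2, inner ℝ (b y) (SQ n N h y)
      ≤ l * Real.sqrt K2 * ∑ w ∈ Icc q.1 q.2, u w := by
    intro q hq
    have hle := hQ.1 q hq
    have hler : (q.1:ℝ) ≤ q.2 := by exact_mod_cast hle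
    have hs : 0 < (q.2:ℝ) - q.1 + 1 := by linarith
    have hcard : ((Icc q.1 q.2).card : ℝ) = (q.2:ℝ) - q.1 + 1 := icc_card_real _ _ (by omega)
    have e3 : ∑ y ∈ Icc q.1 q.2, inner ℝ (b y) (SQ n N h y)
        = ∑ y ∈ Icc q.1 q.2, inner ℝ (b y) (SQ n N h y - SQ n N h q.1) := by
      simp only [inner_sub_right, sum_sub_distrib]
      rw [← sum_inner, hbc q hq, inner_zero_left, sub_zero]
    have e4 : ∀ w ∈ Icc q.1 q.2, ∑ y ∈ Icc q.1 q.2, inner ℝ (b y) (SQ n N h y)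
        ≤ l * ((q.2:ℝ) - q.1 + 1) * (Real.sqrt K2 * u w) := by
      intro w hw
      rw [e3]
      calc _ ≤ ∑ y ∈ Icc q.1 q.2, ‖b y‖ * (Real.sqrt K2 * u w) := by
            refine sum_le_sum fun y hy => (real_inner_le_norm _ _).trans ?_
            gcongr
            exact hosc q hq y hy w hw
        _ ≤ _ := by
            rw [← sum_mul]
            exact mul_le_mul_of_nonneg_right (hbl q hq) (mul_nonneg (Real.sqrt_nonneg _) (hu0 w))
    have e5 := sum_le_sum e4
    rw [sum_const, nsmul_eq_mul, hcard] at e5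
    apply le_of_mul_le_mul_left _ hs
    refine e5.trans (le_of_eq ?_)
    rw [mul_sum, mul_sum]
    refine sum_congr rfl fun w _ => by ring
  have e6 : X ≤ l * Real.sqrt K2 * ∑ w ∈ Ω, u w := by
    rw [e1, hQ.sum_eq Ω hΩm u, mul_sum]
    exact sum_le_sum e2
  have hΩcard : (Ω.card : ℝ) = ∑ q ∈ Q, ((q.2:ℝ) - q.1 + 1) := by
    have := hQ.sum_eq Ω hΩm (fun _ => (1:ℝ))
    simp only [sum_const, nsmul_eq_mul, mul_one] at this
    rw [this]
    exact sum_congr rfl fun q hq => icc_card_real _ _ (by have := hQ.1 q hq; omega)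
  have e7 : (∑ w ∈ Ω, u w) ^ 2 ≤ Ω.card * (C * X) := by
    refine sq_sum_le_card_mul_sum_sq.trans ?_
    gcongr
    simp only [hu2]
    refine (H Ω W' φ hφ hφW).trans (le_of_eq ?_)
    congr 1
    refine sum_congr rfl fun x hx => ?_
    rw [hφdef]
    simp only
    rw [← Real.rpow_mul (abs_nonneg _)]
    simp only [hh, if_pos hx]
    norm_num
  rw [← hΩcard]
  have e8 : X ^ 2 ≤ K2 * C * X * (l ^ 2 * Ω.card) := by
    calc X ^ 2 ≤ (l * Real.sqrt K2 * ∑ w ∈ Ω, u w) ^ 2 := by gcongr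
      _ = l ^ 2 * K2 * (∑ w ∈ Ω, u w) ^ 2 := by rw [mul_pow, mul_pow, Real.sq_sqrt hK20]
      _ ≤ l ^ 2 * K2 * (Ω.card * (C * X)) := by gcongr
      _ = _ := by ring
  rw [mul_assoc]
  exact cs_bound X _ _ hX0 e8 (by positivity)


lemma len_sum_nonneg {Q : Finset (ℤ × ℤ)} (hQ : IFam Q) : 0 ≤ ∑ q ∈ Q, ((q.2:ℝ) - q.1 + 1) :=
  sum_nonneg fun q hq => by
    have : (q.1:ℝ) ≤ q.2 := by exact_mod_cast hQ.1 q hq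
    linarith

lemma HOff.mono {E F : Type} [NormedAddCommGroup E] [NormedAddCommGroup F] {A A' : ℝ}
    {T : (ℤ → E) → (ℤ → F)} (h : HOff A T) (hA : A ≤ A') : HOff A' T := by
  intro l hl Q hQ b h1 h2 h3 W' hW'
  refine (h l hl Q hQ b h1 h2 h3 W' hW').trans ?_
  have := len_sum_nonneg hQ
  gcongr

lemma HTwo.mono {E F : Type} [NormedAddCommGroup E] [NormedAddCommGroup F] {A A' : ℝ}
    {T : (ℤ → E) → (ℤ → F)} (h : HTwo A T) (hA : A ≤ A') : HTwo A' T := by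
  intro W' W f hf
  refine (h W' W f hf).trans ?_
  have : 0 ≤ ∑ x ∈ W, ‖f x‖ ^ 2 := sum_nonneg fun _ _ => sq_nonneg _
  gcongr

lemma dual_bound (p C X F : ℝ) (hp : 1 < p) (hC : 0 < C) (hX : 0 ≤ X) (hF : 0 ≤ F)
    (h : X ≤ F ^ (1/p) * (C * X) ^ (1/(p/(p-1)))) : X ≤ C ^ (p-1) * F := by
  rcases hX.eq_or_lt with h0 | h0
  · rw [← h0]; positivity
  have h1 : X ^ p ≤ (F ^ (1/p) * (C * X) ^ (1/(p/(p-1)))) ^ p := Real.rpow_le_rpow hX h (by linarith)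
  have hp0 : p ≠ 0 := by linarith
  have hp1 : p - 1 ≠ 0 := by linarith
  rw [Real.mul_rpow (by positivity) (by positivity), ← Real.rpow_mul hF, ← Real.rpow_mul (by positivity),
    one_div_mul_cancel hp0, Real.rpow_one] at h1
  have e : 1/(p/(p-1)) * p = p - 1 := by field_simp
  rw [e, Real.mul_rpow hC.le hX] at h1
  have e2 : X ^ p = X * X ^ (p-1) := by
    rw [← Real.rpow_one_add' hX (by linarith)]; congr 1; ring
  rw [e2] at h1
  have h3 : 0 < X ^ (p-1) := Real.rpow_pos_of_pos h0 _
  apply le_of_mul_le_mul_right _ h3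
  linarith

lemma z_thm (p : ℝ) (hp : 1 < p) : ∃ C : ℝ, 0 < C ∧ ∀ (N : ℕ) (n : ℕ → ℕ), StrictMono n → (∀ i, 0 < n i) →
    ∀ (W' W : Finset ℤ) (f : ℤ → ℝ), (∀ x ∉ W, f x = 0) →
      ∑ x ∈ W', ‖SQ n N f x‖ ^ p ≤ C * ∑ x ∈ W, |f x| ^ p := by
  classical
  rcases lt_trichotomy p 2 with h2 | h2 | h2
  · obtain ⟨C, hC, H⟩ := cz_abstract p 16 hp h2 (by norm_num)
    refine ⟨C, hC, fun N n hn hn0 W' W f hf => ?_⟩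
    exact H ℝ (EuclideanSpace ℝ (Fin N)) (SQ n N) (SQ_add n N) (SQ_two n hn hn0 N)
      ((SQ_off n hn N).mono (by norm_num)) W' W f hf
  · refine ⟨16, by norm_num, fun N n hn hn0 W' W f hf => ?_⟩
    have := SQ_two n hn hn0 N W' W f hf
    simp only [h2, Real.rpow_two]
    exact this
  · obtain ⟨A, hA, HA⟩ := SA_off
    have hp1 : 0 < p - 1 := by linarith
    set p' := p / (p-1) with hp'
    have hp'1 : 1 < p' := by rw [hp', lt_div_iff₀ hp1]; linarith
    have hp'2 : p' < 2 := by rw [hp', div_lt_iff₀ hp1]; linarith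
    have hconj : p.HolderConjugate p' := by
      exact Real.HolderConjugate.conjExponent hp
    obtain ⟨C, hC, H⟩ := cz_abstract p' (max 16 A) hp'1 hp'2 (by positivity)
    refine ⟨C ^ (p-1), by positivity, fun N n hn hn0 W' W f hf => ?_⟩
    set u := SQ n N f with hu
    set g : ℤ → EuclideanSpace ℝ (Fin N) := fun y => if y ∈ W' then ‖u y‖ ^ (p-2) • u y else 0 with hg
    have hg0 : ∀ y ∉ W', g y = 0 := fun y hy => by simp [hg, hy]
    have hgn : ∀ y ∈ W', ‖g y‖ ^ p' = ‖u y‖ ^ p := by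
      intro y hy
      simp only [hg, if_pos hy, norm_smul]
      rw [Real.norm_of_nonneg (by positivity)]
      have : ‖u y‖ ^ (p-2) * ‖u y‖ = ‖u y‖ ^ (p-1) := by
        rw [← Real.rpow_add_one' (norm_nonneg _) (by linarith)]; congr 1; ring
      rw [this, ← Real.rpow_mul (norm_nonneg _), hp', mul_div_cancel₀ _ hp1.ne']
    have h1 := H (EuclideanSpace ℝ (Fin N)) ℝ (SA n N) (SA_add n N) ((SA_two n hn hn0 N).mono (le_max_left _ _))
      ((HA n hn N).mono (le_max_right _ _)) W W' g hg0
    rw [sum_congr rfl hgn] at h1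
    apply dual_bound p C _ _ hp hC (sum_nonneg fun _ _ => by positivity) (sum_nonneg fun _ _ => by positivity)
    have e1 : ∑ x ∈ W', ‖u x‖ ^ p = ∑ x ∈ W, f x * SA n N g x := by
      rw [SQ_SA n N W W' f g hf hg0]
      refine sum_congr rfl fun y hy => ?_
      simp only [hg, if_pos hy]
      rw [real_inner_smul_left, real_inner_self_eq_norm_sq, ← Real.rpow_natCast,
        ← Real.rpow_add_of_nonneg (norm_nonneg _) (by linarith) (by norm_num)]
      congr 1; push_cast; ring
    rw [e1]
    refine (Real.inner_le_Lp_mul_Lq W f (SA n N g) hconj).trans ?_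
    rw [← e1]
    have h3 : 0 ≤ 1 / p' := by positivity
    gcongr
    exact h1

/-- complex averages -/
noncomputable def cavg (n : ℕ) (f : ℤ → ℂ) (x : ℤ) : ℂ :=
  (2 * (n:ℂ) + 1)⁻¹ * (∑ k ∈ Icc (-(n:ℤ)) n, f (x + k))

lemma cavg_re (n : ℕ) (f : ℤ → ℂ) (x : ℤ) : (cavg n f x).re = zavg n (fun k => (f k).re) x := by
  rw [cavg, dcast, ← Complex.ofReal_inv, Complex.re_ofReal_mul, zavg, Complex.re_sum, inv_mul_eq_div]

lemma cavg_im (n : ℕ) (f : ℤ → ℂ) (x : ℤ) : (cavg n f x).im = zavg n (fun k => (f k).im) x := by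
  rw [cavg, dcast, ← Complex.ofReal_inv, Complex.im_ofReal_mul, zavg, Complex.im_sum, inv_mul_eq_div]

lemma two_sq_rpow (p a b : ℝ) (hp : 1 ≤ p) (ha : 0 ≤ a) (hb : 0 ≤ b) :
    (a ^ 2 + b ^ 2) ^ (p/2) ≤ 2 ^ (p-1) * (a ^ p + b ^ p) := by
  have h1 : (a ^ 2 + b ^ 2) ^ (p/2) ≤ ((a + b) ^ 2) ^ (p/2) := by
    apply Real.rpow_le_rpow (by positivity) (by nlinarith) (by linarith)
  have h2 : ((a + b) ^ 2) ^ (p/2) = (a + b) ^ p := by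
    rw [← Real.rpow_natCast, ← Real.rpow_mul (by positivity)]; congr 1; push_cast; ring
  rw [h2] at h1
  refine h1.trans ?_
  lift a to NNReal using ha
  lift b to NNReal using hb
  exact_mod_cast NNReal.rpow_add_le_mul_rpow_add_rpow a b hp

lemma z_thm_complex (p : ℝ) (hp : 1 < p) : ∃ C : ℝ, 0 < C ∧ ∀ (N : ℕ) (n : ℕ → ℕ), StrictMono n → (∀ i, 0 < n i) →
    ∀ (W' W : Finset ℤ) (f : ℤ → ℂ), (∀ x ∉ W, f x = 0) →
      ∑ x ∈ W', (∑ i ∈ range N, ‖cavg (n i) f x - cavg (n (i+1)) f x‖ ^ 2) ^ (p/2)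
        ≤ C * ∑ x ∈ W, ‖f x‖ ^ p := by
  obtain ⟨C, hC, H⟩ := z_thm p hp
  refine ⟨2 ^ (p-1) * (2 * C), by positivity, fun N n hn hn0 W' W f hf => ?_⟩
  set f1 : ℤ → ℝ := fun k => (f k).re with hf1
  set f2 : ℤ → ℝ := fun k => (f k).im with hf2
  have e : ∀ x, ∑ i ∈ range N, ‖cavg (n i) f x - cavg (n (i+1)) f x‖ ^ 2
      = ‖SQ n N f1 x‖ ^ 2 + ‖SQ n N f2 x‖ ^ 2 := by
    intro x
    rw [SQ_norm_sq, SQ_norm_sq, ← sum_add_distrib]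
    refine sum_congr rfl fun i _ => ?_
    rw [← Complex.normSq_eq_norm_sq, Complex.normSq_apply, Complex.sub_re, Complex.sub_im,
      cavg_re, cavg_re, cavg_im, cavg_im]
    ring
  simp only [e]
  calc _ ≤ ∑ x ∈ W', 2 ^ (p-1) * (‖SQ n N f1 x‖ ^ p + ‖SQ n N f2 x‖ ^ p) :=
        sum_le_sum fun x _ => two_sq_rpow p _ _ hp.le (norm_nonneg _) (norm_nonneg _)
    _ = 2 ^ (p-1) * (∑ x ∈ W', ‖SQ n N f1 x‖ ^ p + ∑ x ∈ W', ‖SQ n N f2 x‖ ^ p) := by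
        rw [← mul_sum, sum_add_distrib]
    _ ≤ 2 ^ (p-1) * (C * ∑ x ∈ W, ‖f x‖ ^ p + C * ∑ x ∈ W, ‖f x‖ ^ p) := by
        have h1 := H N n hn hn0 W' W f1 (fun x hx => by simp [hf1, hf x hx])
        have h2 := H N n hn hn0 W' W f2 (fun x hx => by simp [hf2, hf x hx])
        have h3 : ∑ x ∈ W, |f1 x| ^ p ≤ ∑ x ∈ W, ‖f x‖ ^ p := sum_le_sum fun x _ =>
          Real.rpow_le_rpow (abs_nonneg _) (Complex.abs_re_le_norm _) (by linarith)
        have h4 : ∑ x ∈ W, |f2 x| ^ p ≤ ∑ x ∈ W, ‖f x‖ ^ p := sum_le_sum fun x _ =>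
          Real.rpow_le_rpow (abs_nonneg _) (Complex.abs_im_le_norm _) (by linarith)
        have h5 := mul_le_mul_of_nonneg_left h3 hC.le
        have h6 := mul_le_mul_of_nonneg_left h4 hC.le
        gcongr
        · linarith
        · linarith
    _ = _ := by ring


/-- moment of a linear functional over the unit ball -/
noncomputable def ballI (d : ℕ) (p : ℝ) (a : EuclideanSpace ℝ (Fin d)) : ℝ≥0∞ :=
  ∫⁻ v in Metric.ball (0 : EuclideanSpace ℝ (Fin d)) 1, ENNReal.ofReal (|inner ℝ a v| ^ p)

lemma ballI_rot (d : ℕ) (p : ℝ) (a b : EuclideanSpace ℝ (Fin d)) (h : ‖a‖ = ‖b‖) :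
    ballI d p a = ballI d p b := by
  set R := (Submodule.span ℝ {a - b})ᗮ.reflection with hR
  have hRa : R a = b := Submodule.reflection_sub h
  have hmp : MeasurePreserving R (volume.restrict (R ⁻¹' (Metric.ball 0 1))) (volume.restrict (Metric.ball 0 1)) :=
    R.measurePreserving.restrict_preimage Metric.isOpen_ball.measurableSet
  have hball : R ⁻¹' (Metric.ball 0 1) = Metric.ball 0 1 := by
    ext v; simp
  rw [hball] at hmp
  have hm : Measurable fun v : EuclideanSpace ℝ (Fin d) => ENNReal.ofReal (|inner ℝ b v| ^ p) := by fun_prop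
  unfold ballI
  rw [← hmp.lintegral_comp hm]
  refine lintegral_congr fun v => ?_
  rw [← hRa, R.inner_map_map]

lemma ballI_smul (d : ℕ) (p : ℝ) (t : ℝ) (ht : 0 ≤ t) (a : EuclideanSpace ℝ (Fin d)) :
    ballI d p (t • a) = ENNReal.ofReal (t ^ p) * ballI d p a := by
  unfold ballI
  rw [← lintegral_const_mul' _ _ ENNReal.ofReal_ne_top]
  refine lintegral_congr fun v => ?_
  rw [← ENNReal.ofReal_mul (by positivity), real_inner_smul_left, abs_mul, abs_of_nonneg ht,
    Real.mul_rpow ht (abs_nonneg _)]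

lemma ballI_eq (d : ℕ) (hd : 0 < d) (p : ℝ) (hp : 0 < p) : ∃ c : ℝ≥0∞, c ≠ 0 ∧ c ≠ ∞ ∧
    ∀ a, ballI d p a = c * ENNReal.ofReal (‖a‖ ^ p) := by
  set e : EuclideanSpace ℝ (Fin d) := EuclideanSpace.single ⟨0, hd⟩ 1 with he
  have hen : ‖e‖ = 1 := by simp [he]
  refine ⟨ballI d p e, ?_, ?_, ?_⟩
  · intro h0
    unfold ballI at h0
    have hm : Measurable fun v : EuclideanSpace ℝ (Fin d) => ENNReal.ofReal (|inner ℝ e v| ^ p) := by fun_prop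
    rw [lintegral_eq_zero_iff hm] at h0
    have h1 : ∀ᵐ v ∂(volume.restrict (Metric.ball (0 : EuclideanSpace ℝ (Fin d)) 1)), inner ℝ e v = 0 := by
      filter_upwards [h0] with v hv
      by_contra hne
      have : 0 < |inner ℝ e v| ^ p := Real.rpow_pos_of_pos (abs_pos.2 hne) _
      simp only [Pi.zero_apply, ENNReal.ofReal_eq_zero] at hv
      linarith
    rw [ae_restrict_iff' Metric.isOpen_ball.measurableSet] at h1
    have hopen : IsOpen (Metric.ball (0 : EuclideanSpace ℝ (Fin d)) 1 ∩ {v | inner ℝ e v ≠ 0}) := by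
      refine Metric.isOpen_ball.inter ?_
      exact isOpen_ne_fun (by fun_prop) (by fun_prop)
    have hne : (Metric.ball (0 : EuclideanSpace ℝ (Fin d)) 1 ∩ {v | inner ℝ e v ≠ 0}).Nonempty := by
      refine ⟨(1/2:ℝ) • e, ?_, ?_⟩
      · rw [mem_ball_zero_iff, norm_smul, hen]; norm_num
      · simp [real_inner_smul_right, real_inner_self_eq_norm_sq, hen]
    have hpos := hopen.measure_pos volume hne
    rw [ae_iff] at h1
    apply hpos.ne'
    rw [← h1]
    congr 1
    ext v; simp
  · unfold ballI
    have : ∫⁻ v in Metric.ball (0 : EuclideanSpace ℝ (Fin d)) 1, ENNReal.ofReal (|inner ℝ e v| ^ p)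
        ≤ ∫⁻ v in Metric.ball (0 : EuclideanSpace ℝ (Fin d)) 1, 1 := by
      refine setLIntegral_mono measurable_const fun v hv => ?_
      rw [mem_ball_zero_iff] at hv
      rw [ENNReal.ofReal_le_one]
      have h1 : |inner ℝ e v| ≤ 1 := by
        refine (abs_real_inner_le_norm e v).trans ?_
        rw [hen, one_mul]; exact hv.le
      exact Real.rpow_le_one (abs_nonneg _) h1 hp.le
    refine ne_top_of_le_ne_top ?_ this
    rw [setLIntegral_one]
    exact measure_ball_lt_top.ne
  · intro a
    rw [ballI_rot d p a (‖a‖ • e) (by rw [norm_smul, hen]; simp), ballI_smul d p _ (norm_nonneg a), mul_comm]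

lemma lin_re (d : ℕ) (z : Fin d → ℂ) (v : EuclideanSpace ℝ (Fin d)) :
    (∑ i, (v i : ℂ) * z i).re = inner ℝ (WithLp.toLp 2 fun i => (z i).re) v := by
  rw [Complex.re_sum, PiLp.inner_apply]
  refine sum_congr rfl fun i _ => ?_
  simp

lemma lin_im (d : ℕ) (z : Fin d → ℂ) (v : EuclideanSpace ℝ (Fin d)) :
    (∑ i, (v i : ℂ) * z i).im = inner ℝ (WithLp.toLp 2 fun i => (z i).im) v := by
  rw [Complex.im_sum, PiLp.inner_apply]
  refine sum_congr rfl fun i _ => ?_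
  simp

lemma ballJ (d : ℕ) (hd : 0 < d) (p : ℝ) (hp : 1 ≤ p) : ∃ c : ℝ≥0∞, c ≠ 0 ∧ c ≠ ∞ ∧
    ∀ z : Fin d → ℂ, 
      c * ENNReal.ofReal ((∑ i, ‖z i‖ ^ 2) ^ (p/2)) ≤ ENNReal.ofReal (2 ^ p) *
        ∫⁻ v in Metric.ball (0 : EuclideanSpace ℝ (Fin d)) 1, ENNReal.ofReal (‖∑ i, (v i : ℂ) * z i‖ ^ p) ∧
      ∫⁻ v in Metric.ball (0 : EuclideanSpace ℝ (Fin d)) 1, ENNReal.ofReal (‖∑ i, (v i : ℂ) * z i‖ ^ p)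
       ≤ ENNReal.ofReal (2 ^ p) * (c * ENNReal.ofReal ((∑ i, ‖z i‖ ^ 2) ^ (p/2))) := by
  obtain ⟨c, hc0, hct, H⟩ := ballI_eq d hd p (by linarith)
  refine ⟨c, hc0, hct, fun z => ?_⟩
  set a : EuclideanSpace ℝ (Fin d) := WithLp.toLp 2 fun i => (z i).re with ha
  set b : EuclideanSpace ℝ (Fin d) := WithLp.toLp 2 fun i => (z i).im with hb
  have hp0 : 0 ≤ p := by linarith
  have hab : ∑ i, ‖z i‖ ^ 2 = ‖a‖ ^ 2 + ‖b‖ ^ 2 := by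
    rw [EuclideanSpace.real_norm_sq_eq, EuclideanSpace.real_norm_sq_eq, ← sum_add_distrib]
    refine sum_congr rfl fun i _ => ?_
    rw [← Complex.normSq_eq_norm_sq, Complex.normSq_apply]
    simp [ha, hb]; ring
  have h2p : ENNReal.ofReal (2 ^ p) = ENNReal.ofReal (2 ^ (p-1)) * 2 := by
    rw [show (2:ℝ≥0∞) = ENNReal.ofReal 2 by simp, ← ENNReal.ofReal_mul (by positivity)]
    congr 1
    rw [← Real.rpow_add_one (by norm_num)]; congr 1; ring
  set J := ∫⁻ v in Metric.ball (0 : EuclideanSpace ℝ (Fin d)) 1, ENNReal.ofReal (‖∑ i, (v i : ℂ) * z i‖ ^ p) with hJ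
  have hpow : ∀ x : ℝ, 0 ≤ x → (x ^ 2) ^ (p/2) = x ^ p := fun x hx => by
    rw [← Real.rpow_natCast, ← Real.rpow_mul hx]; congr 1; push_cast; ring
  constructor
  · have h1 : ballI d p a ≤ J := by
      refine lintegral_mono fun v => ENNReal.ofReal_le_ofReal ?_
      rw [ha, ← lin_re]
      exact Real.rpow_le_rpow (abs_nonneg _) (Complex.abs_re_le_norm _) hp0
    have h2 : ballI d p b ≤ J := by
      refine lintegral_mono fun v => ENNReal.ofReal_le_ofReal ?_
      rw [hb, ← lin_im]
      exact Real.rpow_le_rpow (abs_nonneg _) (Complex.abs_im_le_norm _) hp0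
    rw [H] at h1 h2
    calc c * ENNReal.ofReal ((∑ i, ‖z i‖ ^ 2) ^ (p/2))
        ≤ c * ENNReal.ofReal (2 ^ (p-1) * (‖a‖ ^ p + ‖b‖ ^ p)) := by
          gcongr
          rw [hab]
          exact two_sq_rpow p _ _ hp (norm_nonneg _) (norm_nonneg _)
      _ = ENNReal.ofReal (2 ^ (p-1)) * (c * ENNReal.ofReal (‖a‖ ^ p) + c * ENNReal.ofReal (‖b‖ ^ p)) := by
          rw [ENNReal.ofReal_mul (by positivity), ENNReal.ofReal_add (by positivity) (by positivity)]; ring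
      _ ≤ ENNReal.ofReal (2 ^ (p-1)) * (J + J) := by gcongr
      _ = _ := by rw [h2p]; ring
  · have hma : Measurable fun v : EuclideanSpace ℝ (Fin d) => ENNReal.ofReal (|inner ℝ a v| ^ p) := by fun_prop
    calc J ≤ ∫⁻ v in Metric.ball (0 : EuclideanSpace ℝ (Fin d)) 1, ENNReal.ofReal (2 ^ (p-1)) *
          (ENNReal.ofReal (|inner ℝ a v| ^ p) + ENNReal.ofReal (|inner ℝ b v| ^ p)) := by
          refine lintegral_mono fun v => ?_
          rw [← ENNReal.ofReal_add (by positivity) (by positivity), ← ENNReal.ofReal_mul (by positivity)]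
          refine ENNReal.ofReal_le_ofReal ?_
          rw [ha, hb, ← lin_re, ← lin_im]
          refine le_trans (le_of_eq ?_) (two_sq_rpow p _ _ hp (abs_nonneg _) (abs_nonneg _))
          rw [← hpow _ (norm_nonneg _)]
          congr 1
          rw [← Complex.normSq_eq_norm_sq, Complex.normSq_apply, sq_abs, sq_abs]; ring
      _ = ENNReal.ofReal (2 ^ (p-1)) * (c * ENNReal.ofReal (‖a‖ ^ p) + c * ENNReal.ofReal (‖b‖ ^ p)) := by
          rw [lintegral_const_mul' _ _ ENNReal.ofReal_ne_top, lintegral_add_left hma, ← H, ← H]; rfl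
      _ ≤ ENNReal.ofReal (2 ^ (p-1)) * (c * ENNReal.ofReal ((∑ i, ‖z i‖ ^ 2) ^ (p/2))
            + c * ENNReal.ofReal ((∑ i, ‖z i‖ ^ 2) ^ (p/2))) := by
          rw [hab, ← hpow _ (norm_nonneg a), ← hpow _ (norm_nonneg b)]
          gcongr
          · nlinarith [norm_nonneg b]
          · nlinarith [norm_nonneg a]
      _ = _ := by rw [h2p]; ring


lemma lp_enorm_rpow {X : Type*} [MeasurableSpace X] {μ : Measure X} {p : ℝ≥0∞} [Fact (1 ≤ p)]
    (hp' : p ≠ ∞) (f : Lp ℂ p μ) :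
    ∫⁻ ω, ENNReal.ofReal (‖f ω‖ ^ p.toReal) ∂μ = ‖f‖ₑ ^ p.toReal := by
  have h1 : (1 : ℝ≥0∞) ≤ p := Fact.out
  have h0 : p ≠ 0 := by rintro rfl; simp at h1
  have hr : 0 < p.toReal := ENNReal.toReal_pos h0 hp'
  rw [Lp.enorm_def, eLpNorm_eq_lintegral_rpow_enorm_toReal h0 hp', ← ENNReal.rpow_mul,
    one_div_mul_cancel hr.ne', ENNReal.rpow_one]
  refine lintegral_congr fun ω => ?_
  rw [← ofReal_norm, ENNReal.ofReal_rpow_of_nonneg (norm_nonneg _) hr.le]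

lemma mz_slice {X : Type*} [MeasurableSpace X] {μ : Measure X} {p : ℝ≥0∞} [Fact (1 ≤ p)]
    (hp' : p ≠ ∞) {d : ℕ} (v : Fin d → ℝ) (g : Fin d → Lp ℂ p μ) :
    ∫⁻ ω, ENNReal.ofReal (‖∑ i, (v i : ℂ) * (g i) ω‖ ^ p.toReal) ∂μ
      = ‖∑ i, (v i : ℂ) • g i‖ₑ ^ p.toReal := by
  rw [← lp_enorm_rpow hp']
  refine lintegral_congr_ae ?_
  have h2 : ∀ᵐ ω ∂μ, ∀ i, ((v i : ℂ) • g i : Lp ℂ p μ) ω = (v i : ℂ) * (g i) ω := by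
    rw [ae_all_iff]
    intro i
    filter_upwards [Lp.coeFn_smul (v i : ℂ) (g i)] with ω h
    rw [h]; simp
  filter_upwards [Lp.coeFn_finsetSum (Finset.univ) (fun i => (v i : ℂ) • g i), h2] with ω h h2
  rw [h, Finset.sum_apply]
  simp only [h2]

lemma mz {X : Type*} [MeasurableSpace X] {μ : Measure X} [SigmaFinite μ] {p : ℝ≥0∞} [Fact (1 ≤ p)]
    (hp' : p ≠ ∞) (S : Lp ℂ p μ →L[ℂ] Lp ℂ p μ) {d : ℕ} (g : Fin d → Lp ℂ p μ) :
    ∫⁻ ω, ENNReal.ofReal ((∑ i, ‖(S (g i)) ω‖ ^ 2) ^ (p.toReal / 2)) ∂μ ≤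
      ENNReal.ofReal (2 ^ p.toReal) * ENNReal.ofReal (2 ^ p.toReal) * ‖S‖ₑ ^ p.toReal *
       ∫⁻ ω, ENNReal.ofReal ((∑ i, ‖(g i) ω‖ ^ 2) ^ (p.toReal / 2)) ∂μ := by
  have h1 : (1 : ℝ≥0∞) ≤ p := Fact.out
  have h0 : p ≠ 0 := by rintro rfl; simp at h1
  have hr : 0 < p.toReal := ENNReal.toReal_pos h0 hp'
  have hr1 : 1 ≤ p.toReal := by
    have := ENNReal.toReal_mono hp' h1
    simpa using this
  rcases Nat.eq_zero_or_pos d with rfl | hd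
  · simp [Real.zero_rpow (by positivity : p.toReal / 2 ≠ 0)]
  obtain ⟨c, hc0, hct, H⟩ := ballJ d hd p.toReal hr1
  set r := p.toReal with hrdef
  set A := ENNReal.ofReal (2 ^ r) with hA
  have hAt : A ≠ ∞ := ENNReal.ofReal_ne_top
  set ν := (volume : Measure (EuclideanSpace ℝ (Fin d))).restrict
    (Metric.ball (0 : EuclideanSpace ℝ (Fin d)) 1) with hν
  have meas : ∀ g : Fin d → Lp ℂ p μ, Measurable (Function.uncurry fun (ω : X)
      (v : EuclideanSpace ℝ (Fin d)) => ENNReal.ofReal (‖∑ i, (v i : ℂ) * (g i) ω‖ ^ r)) := by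
    intro g
    have hg : ∀ i, Measurable (g i) := fun i => (Lp.stronglyMeasurable (g i)).measurable
    have : Measurable fun q : X × EuclideanSpace ℝ (Fin d) =>
        ENNReal.ofReal (‖∑ i, ((q.2 i : ℝ) : ℂ) * (g i) q.1‖ ^ r) := by
      have hv : ∀ i : Fin d, Measurable fun q : X × EuclideanSpace ℝ (Fin d) => q.2 i := by
        intro i; fun_prop
      refine ENNReal.measurable_ofReal.comp ?_
      refine Measurable.pow_const ?_ _
      refine Measurable.norm ?_
      refine Finset.measurable_sum _ fun i _ => ?_
      exact (Complex.measurable_ofReal.comp (hv i)).mul ((hg i).comp measurable_fst)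
    exact this
  have swap : ∀ g : Fin d → Lp ℂ p μ,
      ∫⁻ ω, ∫⁻ v, ENNReal.ofReal (‖∑ i, (v i : ℂ) * (g i) ω‖ ^ r) ∂ν ∂μ
        = ∫⁻ v, ‖∑ i, (v i : ℂ) • g i‖ₑ ^ r ∂ν := by
    intro g
    rw [lintegral_lintegral_swap (meas g).aemeasurable]
    exact lintegral_congr fun v => mz_slice hp' _ g
  have key : c * ∫⁻ ω, ENNReal.ofReal ((∑ i, ‖(S (g i)) ω‖ ^ 2) ^ (r / 2)) ∂μ ≤
      c * (A * A * ‖S‖ₑ ^ r * ∫⁻ ω, ENNReal.ofReal ((∑ i, ‖(g i) ω‖ ^ 2) ^ (r / 2)) ∂μ) := by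
    calc c * ∫⁻ ω, ENNReal.ofReal ((∑ i, ‖(S (g i)) ω‖ ^ 2) ^ (r / 2)) ∂μ
        = ∫⁻ ω, c * ENNReal.ofReal ((∑ i, ‖(S (g i)) ω‖ ^ 2) ^ (r / 2)) ∂μ :=
          (lintegral_const_mul' _ _ hct).symm
      _ ≤ ∫⁻ ω, A * ∫⁻ v, ENNReal.ofReal (‖∑ i, (v i : ℂ) * (S (g i)) ω‖ ^ r) ∂ν ∂μ :=
          lintegral_mono fun ω => (H fun i => (S (g i)) ω).1
      _ = A * ∫⁻ v, ‖∑ i, (v i : ℂ) • S (g i)‖ₑ ^ r ∂ν := by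
          rw [lintegral_const_mul' _ _ hAt, swap fun i => S (g i)]
      _ ≤ A * ∫⁻ v, ‖S‖ₑ ^ r * ‖∑ i, (v i : ℂ) • g i‖ₑ ^ r ∂ν := by
          gcongr with v
          rw [← ENNReal.mul_rpow_of_nonneg _ _ hr.le]
          gcongr
          have : ∑ i, ((v i : ℝ) : ℂ) • S (g i) = S (∑ i, ((v i : ℝ) : ℂ) • g i) := by
            rw [map_sum]
            exact sum_congr rfl fun i _ => (map_smul S _ _).symm
          rw [this]
          exact S.le_opENorm _
      _ = A * ‖S‖ₑ ^ r * ∫⁻ ω, ∫⁻ v, ENNReal.ofReal (‖∑ i, (v i : ℂ) * (g i) ω‖ ^ r) ∂ν ∂μ := by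
          rw [lintegral_const_mul' _ _ (ENNReal.rpow_ne_top_of_nonneg hr.le enorm_ne_top), swap g,
            mul_assoc]
      _ ≤ A * ‖S‖ₑ ^ r * ∫⁻ ω, A * (c * ENNReal.ofReal ((∑ i, ‖(g i) ω‖ ^ 2) ^ (r / 2))) ∂μ := by
          gcongr with ω
          exact (H fun i => (g i) ω).2
      _ = _ := by
          rw [lintegral_const_mul' _ _ hAt, lintegral_const_mul' _ _ hct]
          ring
  exact (ENNReal.mul_le_mul_iff_right hc0 hct).1 key

lemma zpow_apply_add {X : Type*} [MeasurableSpace X] {μ : Measure X} {p : ℝ≥0∞} [Fact (1 ≤ p)]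
    (T : Lp ℂ p μ ≃L[ℂ] Lp ℂ p μ) (a b : ℤ) (x : Lp ℂ p μ) :
    (T ^ a) ((T ^ b) x) = (T ^ (a + b)) x := by
  rw [zpow_add]; rfl

lemma zpow_avg {X : Type*} [MeasurableSpace X] {μ : Measure X} {p : ℝ≥0∞} [Fact (1 ≤ p)]
    (T : Lp ℂ p μ ≃L[ℂ] Lp ℂ p μ) (m : ℤ) (n : ℕ) (x : Lp ℂ p μ) :
    (T ^ m) (ergAvgTwoSided T n x) =
      (2 * (n : ℂ) + 1)⁻¹ • ∑ k ∈ Icc (-(n : ℤ)) n, (T ^ (m + k)) x := by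
  simp only [ergAvgTwoSided, ContinuousLinearMap.smul_apply, ContinuousLinearMap.sum_apply,
    map_smul, map_sum, ContinuousLinearEquiv.coe_coe, zpow_apply_add]

lemma zpow_avg_ae {X : Type*} [MeasurableSpace X] {μ : Measure X} {p : ℝ≥0∞} [Fact (1 ≤ p)]
    (T : Lp ℂ p μ ≃L[ℂ] Lp ℂ p μ) (L : ℕ) (m : ℤ) (hm : m ∈ Icc (-(L : ℤ)) L)
    (n : ℕ) (hn : n ≤ L) (x : Lp ℂ p μ) :
    ∀ᵐ ω ∂μ, ((T ^ m) (ergAvgTwoSided T n x)) ω =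
      cavg n (fun k => if k ∈ Icc (-(2 * L : ℤ)) (2 * L) then ((T ^ k) x) ω else 0) m := by
  rw [zpow_avg]
  filter_upwards [Lp.coeFn_smul (2 * (n : ℂ) + 1)⁻¹ (∑ k ∈ Icc (-(n : ℤ)) n, (T ^ (m + k)) x),
    Lp.coeFn_finsetSum (Icc (-(n : ℤ)) n) (fun k => (T ^ (m + k)) x)] with ω h1 h2
  rw [h1, Pi.smul_apply, h2, Finset.sum_apply, cavg, smul_eq_mul]
  congr 1
  refine sum_congr rfl fun k hk => ?_
  rw [if_pos]
  rw [mem_Icc] at *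
  omega

lemma transf {p : ℝ≥0∞} [Fact (1 ≤ p)] (hp : 1 < p) (hp' : p ≠ ∞) (K : ℝ) (hK : 0 < K) (C : ℝ)
    (hC : 0 < C)
    (HC : ∀ (N : ℕ) (n : ℕ → ℕ), StrictMono n → (∀ i, 0 < n i) → ∀ (W' W : Finset ℤ) (f : ℤ → ℂ),
      (∀ x ∉ W, f x = 0) →
      ∑ x ∈ W', (∑ i ∈ range N, ‖cavg (n i) f x - cavg (n (i + 1)) f x‖ ^ 2) ^ (p.toReal / 2)
        ≤ C * ∑ x ∈ W, ‖f x‖ ^ p.toReal)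
    {X : Type*} [MeasurableSpace X] {μ : Measure X} [SigmaFinite μ]
    (T : Lp ℂ p μ ≃L[ℂ] Lp ℂ p μ)
    (hT : ∀ k : ℤ, ‖((T ^ k : Lp ℂ p μ ≃L[ℂ] Lp ℂ p μ) : Lp ℂ p μ →L[ℂ] Lp ℂ p μ)‖ ≤ K)
    (N : ℕ) (n : ℕ → ℕ) (hn : StrictMono n) (hpos : ∀ i, 0 < n i) (x : Lp ℂ p μ) :
    ∫⁻ ω, ENNReal.ofReal ((∑ i ∈ range N,
      ‖(ergAvgTwoSided T (n i) x) ω - (ergAvgTwoSided T (n (i + 1)) x) ω‖ ^ 2) ^ (p.toReal / 2)) ∂μ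
    ≤ ENNReal.ofReal (2 ^ p.toReal * 2 ^ p.toReal * K ^ p.toReal * C * 2 * K ^ p.toReal
        * ‖x‖ ^ p.toReal) := by
  have h1 : (1 : ℝ≥0∞) ≤ p := Fact.out
  have h0 : p ≠ 0 := by rintro rfl; simp at h1
  have hr : 0 < p.toReal := ENNReal.toReal_pos h0 hp'
  set r := p.toReal with hrdef
  have hTe : ∀ k : ℤ, ‖((T ^ k : Lp ℂ p μ ≃L[ℂ] Lp ℂ p μ) : Lp ℂ p μ →L[ℂ] Lp ℂ p μ)‖ₑ ^ r
      ≤ ENNReal.ofReal (K ^ r) := by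
    intro k
    rw [← ENNReal.ofReal_rpow_of_nonneg hK.le hr.le, ← ofReal_norm]
    gcongr
    exact hT k
  set L := n N with hL
  set y : ℕ → Lp ℂ p μ := fun i => ergAvgTwoSided T (n i) x - ergAvgTwoSided T (n (i + 1)) x with hy
  set I := ∫⁻ ω, ENNReal.ofReal ((∑ i ∈ range N, ‖(y i) ω‖ ^ 2) ^ (r / 2)) ∂μ with hI
  have e1 : ∫⁻ ω, ENNReal.ofReal ((∑ i ∈ range N,
      ‖(ergAvgTwoSided T (n i) x) ω - (ergAvgTwoSided T (n (i + 1)) x) ω‖ ^ 2) ^ (r / 2)) ∂μ = I := by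
    refine lintegral_congr_ae ?_
    have : ∀ᵐ ω ∂μ, ∀ i, (y i) ω =
        (ergAvgTwoSided T (n i) x) ω - (ergAvgTwoSided T (n (i + 1)) x) ω := by
      rw [ae_all_iff]
      intro i
      filter_upwards [Lp.coeFn_sub (ergAvgTwoSided T (n i) x) (ergAvgTwoSided T (n (i + 1)) x)]
        with ω h
      rw [hy, h]; rfl
    filter_upwards [this] with ω h
    simp only [h]
  rw [e1]
  set F : X → ℤ → ℂ := fun ω k => if k ∈ Icc (-(2 * L : ℤ)) (2 * L) then ((T ^ k) x) ω else 0 with hF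
  set D := ENNReal.ofReal (2 ^ r) * ENNReal.ofReal (2 ^ r) * ENNReal.ofReal (K ^ r) with hD
  have hDt : D ≠ ∞ := by simp [hD, ENNReal.mul_eq_top]
  -- step 1
  have s1 : ∀ m ∈ Icc (-(L : ℤ)) L, I ≤ D * ∫⁻ ω, ENNReal.ofReal ((∑ i ∈ range N,
      ‖cavg (n i) (F ω) m - cavg (n (i + 1)) (F ω) m‖ ^ 2) ^ (r / 2)) ∂μ := by
    intro m hm
    have A := mz hp' ((T ^ (-m) : Lp ℂ p μ ≃L[ℂ] Lp ℂ p μ) : Lp ℂ p μ →L[ℂ] Lp ℂ p μ)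
      (fun i : Fin N => (T ^ m) (y i))
    have hinv : ∀ z, (T ^ (-m)) ((T ^ m) z) = z := by
      intro z
      rw [zpow_apply_add, neg_add_cancel, zpow_zero]; rfl
    simp only [ContinuousLinearEquiv.coe_coe, hinv] at A
    have B : ∫⁻ ω, ENNReal.ofReal ((∑ i : Fin N, ‖((T ^ m) (y i)) ω‖ ^ 2) ^ (r / 2)) ∂μ =
      ∫⁻ ω, ENNReal.ofReal ((∑ i ∈ range N,
      ‖cavg (n i) (F ω) m - cavg (n (i + 1)) (F ω) m‖ ^ 2) ^ (r / 2)) ∂μ := by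
      refine lintegral_congr_ae ?_
      have : ∀ᵐ ω ∂μ, ∀ i : Fin N, ((T ^ m) (y i)) ω =
          cavg (n i) (F ω) m - cavg (n (i + 1)) (F ω) m := by
        rw [ae_all_iff]
        intro i
        have hi1 : n i ≤ L := hn.monotone i.2.le
        have hi2 : n (i + 1) ≤ L := hn.monotone i.2
        have e : (T ^ m) (y i) = (T ^ m) (ergAvgTwoSided T (n i) x)
          - (T ^ m) (ergAvgTwoSided T (n (i + 1)) x) := map_sub _ _ _
        rw [e]
        filter_upwards [Lp.coeFn_sub ((T ^ m) (ergAvgTwoSided T (n i) x))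
          ((T ^ m) (ergAvgTwoSided T (n (i + 1)) x)), zpow_avg_ae T L m hm _ hi1 x,
          zpow_avg_ae T L m hm _ hi2 x] with ω g1 g2 g3
        rw [g1, Pi.sub_apply, g2, g3]
      filter_upwards [this] with ω h
      simp only [h]
      rw [Fin.sum_univ_eq_sum_range
        (fun i => ‖cavg (n i) (F ω) m - cavg (n (i + 1)) (F ω) m‖ ^ 2) N]
    rw [B] at A
    have A' : I ≤ ENNReal.ofReal (2 ^ r) * ENNReal.ofReal (2 ^ r) * 
        ‖((T ^ (-m) : Lp ℂ p μ ≃L[ℂ] Lp ℂ p μ) : Lp ℂ p μ →L[ℂ] Lp ℂ p μ)‖ₑ ^ r *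
        ∫⁻ ω, ENNReal.ofReal ((∑ i ∈ range N,
      ‖cavg (n i) (F ω) m - cavg (n (i + 1)) (F ω) m‖ ^ 2) ^ (r / 2)) ∂μ := by
      refine le_trans (le_of_eq ?_) A
      refine lintegral_congr fun ω => ?_
      rw [Fin.sum_univ_eq_sum_range (fun i => ‖(y i) ω‖ ^ 2) N]
    refine A'.trans ?_
    rw [hD]
    gcongr
    exact hTe _
  have hFm : ∀ k, Measurable fun ω => F ω k := by
    intro k
    simp only [hF]
    split_ifs
    · exact (Lp.stronglyMeasurable _).measurable
    · exact measurable_const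
  have hcm : ∀ (j : ℕ) (m : ℤ), Measurable fun ω => cavg j (F ω) m := by
    intro j m
    unfold cavg
    exact (Finset.measurable_sum _ fun k _ => hFm _).const_mul _
  have hGm : ∀ m : ℤ, Measurable fun ω => ENNReal.ofReal ((∑ i ∈ range N,
      ‖cavg (n i) (F ω) m - cavg (n (i + 1)) (F ω) m‖ ^ 2) ^ (r / 2)) := by
    intro m
    refine ENNReal.measurable_ofReal.comp ?_
    refine Measurable.pow_const ?_ _
    exact Finset.measurable_sum _ fun i _ => (((hcm _ _).sub (hcm _ _)).norm).pow_const _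
  have s2 : ((2 * L + 1 : ℕ) : ℝ≥0∞) * I ≤ D * (ENNReal.ofReal C *
      ∑ k ∈ Icc (-(2 * L : ℤ)) (2 * L), ‖(T ^ k) x‖ₑ ^ r) := by
    calc ((2 * L + 1 : ℕ) : ℝ≥0∞) * I = ∑ m ∈ Icc (-(L : ℤ)) L, I := by
          rw [sum_const, nsmul_eq_mul, Int.card_Icc]
          congr 2
          omega
      _ ≤ ∑ m ∈ Icc (-(L : ℤ)) L, D * ∫⁻ ω, ENNReal.ofReal ((∑ i ∈ range N,
            ‖cavg (n i) (F ω) m - cavg (n (i + 1)) (F ω) m‖ ^ 2) ^ (r / 2)) ∂μ := sum_le_sum s1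
      _ = D * ∫⁻ ω, ENNReal.ofReal (∑ m ∈ Icc (-(L : ℤ)) L, (∑ i ∈ range N,
            ‖cavg (n i) (F ω) m - cavg (n (i + 1)) (F ω) m‖ ^ 2) ^ (r / 2)) ∂μ := by
          rw [← mul_sum, ← lintegral_finsetSum _ (fun m _ => hGm m)]
          congr 1
          refine lintegral_congr fun ω => ?_
          rw [ENNReal.ofReal_sum_of_nonneg]
          intro m _
          positivity
      _ ≤ D * ∫⁻ ω, ENNReal.ofReal C * ∑ k ∈ Icc (-(2 * L : ℤ)) (2 * L),
            ENNReal.ofReal (‖((T ^ k) x) ω‖ ^ r) ∂μ := by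
          gcongr with ω
          rw [← ENNReal.ofReal_sum_of_nonneg (fun k _ => by positivity), ← ENNReal.ofReal_mul hC.le]
          refine ENNReal.ofReal_le_ofReal ?_
          refine (HC N n hn hpos (Icc (-(L : ℤ)) L) (Icc (-(2 * L : ℤ)) (2 * L)) (F ω) ?_).trans
            (le_of_eq ?_)
          · intro k hk
            simp only [hF, if_neg hk]
          · congr 1
            refine sum_congr rfl fun k hk => ?_
            simp only [hF, if_pos hk]
      _ = _ := by
          rw [lintegral_const_mul' _ _ ENNReal.ofReal_ne_top, lintegral_finsetSum]
          · simp only [lp_enorm_rpow hp', hrdef]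
          · intro k _
            exact ENNReal.measurable_ofReal.comp
              (((Lp.stronglyMeasurable ((T ^ k) x)).measurable.norm).pow_const _)
  have s3 : ∑ k ∈ Icc (-(2 * L : ℤ)) (2 * L), ‖(T ^ k) x‖ₑ ^ r
      ≤ ((2 * L + 1 : ℕ) : ℝ≥0∞) * (2 * (ENNReal.ofReal (K ^ r) * ‖x‖ₑ ^ r)) := by
    calc ∑ k ∈ Icc (-(2 * L : ℤ)) (2 * L), ‖(T ^ k) x‖ₑ ^ r
        ≤ ∑ k ∈ Icc (-(2 * L : ℤ)) (2 * L), ENNReal.ofReal (K ^ r) * ‖x‖ₑ ^ r := by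
          refine sum_le_sum fun k _ => ?_
          calc ‖(T ^ k) x‖ₑ ^ r ≤ (‖((T ^ k : Lp ℂ p μ ≃L[ℂ] Lp ℂ p μ) :
              Lp ℂ p μ →L[ℂ] Lp ℂ p μ)‖ₑ * ‖x‖ₑ) ^ r := by
                gcongr
                exact ContinuousLinearMap.le_opENorm
                  ((T ^ k : Lp ℂ p μ ≃L[ℂ] Lp ℂ p μ) : Lp ℂ p μ →L[ℂ] Lp ℂ p μ) x
            _ ≤ _ := by
                rw [ENNReal.mul_rpow_of_nonneg _ _ hr.le]
                gcongr
                exact hTe k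
      _ = ((4 * L + 1 : ℕ) : ℝ≥0∞) * (ENNReal.ofReal (K ^ r) * ‖x‖ₑ ^ r) := by
          rw [sum_const, nsmul_eq_mul, Int.card_Icc]
          congr 2
          omega
      _ ≤ ((2 * (2 * L + 1) : ℕ) : ℝ≥0∞) * (ENNReal.ofReal (K ^ r) * ‖x‖ₑ ^ r) := by
          gcongr
          omega
      _ = _ := by push_cast; ring
  have s4 : ((2 * L + 1 : ℕ) : ℝ≥0∞) * I ≤ ((2 * L + 1 : ℕ) : ℝ≥0∞) *
      (D * (ENNReal.ofReal C * (2 * (ENNReal.ofReal (K ^ r) * ‖x‖ₑ ^ r)))) := by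
    calc _ ≤ _ := s2
      _ ≤ D * (ENNReal.ofReal C * (((2 * L + 1 : ℕ) : ℝ≥0∞) *
          (2 * (ENNReal.ofReal (K ^ r) * ‖x‖ₑ ^ r)))) := by gcongr
      _ = _ := by ring
  have s5 := (ENNReal.mul_le_mul_iff_right (by simp) (ENNReal.natCast_ne_top _)).1 s4
  refine s5.trans (le_of_eq ?_)
  rw [← ofReal_norm, ENNReal.ofReal_rpow_of_nonneg (norm_nonneg _) hr.le, hD,
    ENNReal.ofReal_mul (by positivity), ENNReal.ofReal_mul (by positivity),
    ENNReal.ofReal_mul (by positivity), ENNReal.ofReal_mul (by positivity),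
    ENNReal.ofReal_mul (by positivity), ENNReal.ofReal_mul (by positivity)]
  rw [ENNReal.ofReal_ofNat]
  ring

/-- Quantitative mean ergodic inequality for invertible power bounded operators on
`L^p`, two-sided averages (commutative case of Theorem 1.1). -/
theorem quantitative_mean_ergodic_power_bounded_two_sided
    (p : ℝ≥0∞) [Fact (1 ≤ p)] (hp : 1 < p) (hp' : p ≠ ∞) (K : ℝ) :
    ∃ C : ℝ, 0 < C ∧
      ∀ (X : Type) [MeasurableSpace X] (μ : Measure X) [SigmaFinite μ]
        (T : Lp ℂ p μ ≃L[ℂ] Lp ℂ p μ),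
        (∀ k : ℤ, ‖((T ^ k : Lp ℂ p μ ≃L[ℂ] Lp ℂ p μ) : Lp ℂ p μ →L[ℂ] Lp ℂ p μ)‖ ≤ K) →
        ∀ (N : ℕ) (n : ℕ → ℕ), StrictMono n → (∀ i, 0 < n i) →
        ∀ x : Lp ℂ p μ,
          eLpNorm
            (fun ω => (∑ i ∈ Finset.range N,
                ‖(ergAvgTwoSided T (n i) x) ω - (ergAvgTwoSided T (n (i + 1)) x) ω‖ ^ 2 : ℝ)
              ^ (1 / 2 : ℝ)) p μ
          ≤ ENNReal.ofReal (C * ‖x‖) := by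
  have h0 : p ≠ 0 := by rintro rfl; simp at hp
  have hr : 0 < p.toReal := ENNReal.toReal_pos h0 hp'
  have hr1 : 1 < p.toReal := by
    have := (ENNReal.toReal_lt_toReal (by simp) hp').2 hp
    simpa using this
  obtain ⟨C, hC, HC⟩ := z_thm_complex p.toReal hr1
  set K' := |K| + 1 with hK'
  have hK0 : 0 < K' := by positivity
  have hKK : K ≤ K' := by have := le_abs_self K; linarith
  set r := p.toReal with hrdef
  set M := 2 ^ r * 2 ^ r * K' ^ r * C * 2 * K' ^ r with hM
  have hM0 : 0 < M := by positivity
  refine ⟨M ^ (1 / r), by positivity, ?_⟩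
  intro X _ μ _ T hT N n hn hpos x
  have key := transf hp hp' K' hK0 C hC HC T (fun k => (hT k).trans hKK) N n hn hpos x
  rw [eLpNorm_eq_lintegral_rpow_enorm_toReal h0 hp']
  have e : ∀ ω, ‖((∑ i ∈ Finset.range N,
      ‖(ergAvgTwoSided T (n i) x) ω - (ergAvgTwoSided T (n (i + 1)) x) ω‖ ^ 2 : ℝ)
              ^ (1 / 2 : ℝ))‖ₑ ^ r = ENNReal.ofReal ((∑ i ∈ range N,
      ‖(ergAvgTwoSided T (n i) x) ω - (ergAvgTwoSided T (n (i + 1)) x) ω‖ ^ 2) ^ (r / 2)) := by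
    intro ω
    have hs : (0 : ℝ) ≤ ∑ i ∈ Finset.range N,
      ‖(ergAvgTwoSided T (n i) x) ω - (ergAvgTwoSided T (n (i + 1)) x) ω‖ ^ 2 := by positivity
    rw [Real.enorm_eq_ofReal (by positivity), ENNReal.ofReal_rpow_of_nonneg (by positivity) hr.le,
      ← Real.rpow_mul hs]
    congr 2
    ring
  rw [lintegral_congr e]
  refine (ENNReal.rpow_le_rpow key (by positivity)).trans (le_of_eq ?_)
  rw [ENNReal.ofReal_rpow_of_nonneg (by positivity) (by positivity),
    Real.mul_rpow hM0.le (by positivity), ← Real.rpow_mul (norm_nonneg _),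
    mul_one_div_cancel hr.ne', Real.rpow_one]
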